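/- arXiv:2507.12285 — 3 statements merged into one kernel-verified Lean document; each statement's English description precedes it below -/
import Mathlib

section
/- Hyperboloidal standard energy estimate: There is a universal constant C > 0 such that for every c ≥ 0, all 2 ≤ s₀ ≤ s₁, and every smooth function u defined on K_{[s₀,s₁]} vanishing on a neighborhood of the boundary {r = t−1}, one has for all s ∈ [s₀,s₁]: E_c(s,u)^{1/2} ≤ E_c(s₀,u)^{1/2} + C ∫_{s₀}^{s} ‖□u + c²u‖_{L²_f(H_τ)} dτ. -/
noncomputable section
open MeasureTheory

/-- Spatial radius `r = |x|` of a space-time point `p = (t, x) ∈ ℝ^{1+3}`. -/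
def rad (p : Fin 4 → ℝ) : ℝ := Real.sqrt (∑ a : Fin 3, (p a.succ) ^ 2)

/-- Partial derivative in the `i`-th coordinate direction (`0` is time). -/
def pd (i : Fin 4) (u : (Fin 4 → ℝ) → ℝ) : (Fin 4 → ℝ) → ℝ :=
  fun p => fderiv ℝ u p (Pi.single i 1)

/-- The flat wave operator `□u = ∂_t∂_t u - Σ_a ∂_a∂_a u`. -/
def box (u : (Fin 4 → ℝ) → ℝ) : (Fin 4 → ℝ) → ℝ :=
  fun p => pd 0 (pd 0 u) p - ∑ a : Fin 3, pd a.succ (pd a.succ u) p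

/-- The point of the hyperboloid `H_s` above `x ∈ ℝ³`: `(√(s² + |x|²), x)`. -/
def hpt (s : ℝ) (x : Fin 3 → ℝ) : Fin 4 → ℝ :=
  Fin.cons (Real.sqrt (s ^ 2 + ∑ a : Fin 3, (x a) ^ 2)) x

/-- The flat `L²` norm on the hyperboloid `H_s`:
`‖w‖_{L²_f(H_s)} = (∫_{ℝ³} |w(√(s²+|x|²), x)|² dx)^{1/2}`. -/
def L2f (s : ℝ) (w : (Fin 4 → ℝ) → ℝ) : ℝ :=
  Real.sqrt (∫ x : Fin 3 → ℝ, (w (hpt s x)) ^ 2)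

/-- The region `K_{[s₀,s₁]} = {(t,x) : s₀² ≤ t² - r² ≤ s₁², r < t - 1}`. -/
def Kset (s₀ s₁ : ℝ) : Set (Fin 4 → ℝ) :=
  {p | s₀ ^ 2 ≤ (p 0) ^ 2 - (rad p) ^ 2 ∧ (p 0) ^ 2 - (rad p) ^ 2 ≤ s₁ ^ 2 ∧ rad p < p 0 - 1}

/-- `u` vanishes on a neighborhood of the boundary `{r = t - 1}` (and outside the cone). -/
def vanishNearBdry (u : (Fin 4 → ℝ) → ℝ) : Prop :=
  ∃ δ > 0, ∀ p : Fin 4 → ℝ, p 0 - 1 - δ ≤ rad p → u p = 0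

/-- The standard hyperboloidal energy `E_c(s,u)`. -/
def Ec (c s : ℝ) (u : (Fin 4 → ℝ) → ℝ) : ℝ :=
  ∫ x : Fin 3 → ℝ,
    ((pd 0 u (hpt s x)) ^ 2 + (∑ a : Fin 3, (pd a.succ u (hpt s x)) ^ 2)
      + 2 * (∑ a : Fin 3, (x a / hpt s x 0) * pd 0 u (hpt s x) * pd a.succ u (hpt s x))
      + c ^ 2 * (u (hpt s x)) ^ 2)

/-- The semi-hyperboloidal derivative `∂̲_a u = (x^a/t) ∂_t u + ∂_a u`. -/
def sdu (a : Fin 3) (u : (Fin 4 → ℝ) → ℝ) : (Fin 4 → ℝ) → ℝ :=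
  fun p => (p a.succ / p 0) * pd 0 u p + pd a.succ u p

/-- `Ku = s(s/t) ∂_t u + 2 Σ_a x^a ∂̲_a u`, with `s = √(t² - r²)`. -/
def Kop (u : (Fin 4 → ℝ) → ℝ) : (Fin 4 → ℝ) → ℝ :=
  fun p =>
    Real.sqrt ((p 0) ^ 2 - (rad p) ^ 2) * (Real.sqrt ((p 0) ^ 2 - (rad p) ^ 2) / p 0)
        * pd 0 u p
      + 2 * ∑ a : Fin 3, p a.succ * sdu a u p

/-- The hyperboloidal conformal energy `E_con(s,u)`. -/
def Econ (s : ℝ) (u : (Fin 4 → ℝ) → ℝ) : ℝ :=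
  ∫ x : Fin 3 → ℝ,
    ((Kop u (hpt s x) + 2 * u (hpt s x)) ^ 2
      + ∑ a : Fin 3, (s * sdu a u (hpt s x)) ^ 2)

open Set Topology

theorem hpt_succ (s : ℝ) (x : Fin 3 → ℝ) (a : Fin 3) : hpt s x a.succ = x a := by
  simp [hpt]

theorem hpt_zero (s : ℝ) (x : Fin 3 → ℝ) :
    hpt s x 0 = Real.sqrt (s ^ 2 + ∑ a : Fin 3, (x a) ^ 2) := by
  simp [hpt]

theorem sq_hpt_zero (s : ℝ) (x : Fin 3 → ℝ) :
    hpt s x 0 ^ 2 = s ^ 2 + ∑ a : Fin 3, (x a) ^ 2 := by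
  rw [hpt_zero, Real.sq_sqrt (by positivity)]

theorem hpt_zero_pos {s : ℝ} (hs : 0 < s) (x : Fin 3 → ℝ) : 0 < hpt s x 0 := by
  rw [hpt_zero]
  positivity

theorem continuous_hpt : Continuous fun q : ℝ × (Fin 3 → ℝ) => hpt q.1 q.2 := by
  refine continuous_pi fun i => ?_
  refine Fin.cases ?_ (fun a => ?_) i
  · simp only [hpt_zero]
    fun_prop
  · simp only [hpt_succ]
    fun_prop

theorem rad_hpt (s : ℝ) (x : Fin 3 → ℝ) :
    rad (hpt s x) = Real.sqrt (∑ a : Fin 3, (x a) ^ 2) := by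
  simp [rad, hpt_succ]

theorem hasDerivAt_spacetime {γ : ℝ → Fin 4 → ℝ} {v : Fin 4 → ℝ} {s : ℝ}
    (h0 : HasDerivAt (fun σ => γ σ 0) (v 0) s)
    (h : ∀ a : Fin 3, HasDerivAt (fun σ => γ σ a.succ) (v a.succ) s) : HasDerivAt γ v s :=
  hasDerivAt_pi.2 (Fin.cases h0 h)

/-- The tangent vector of `s ↦ hpt s x` is `(s / t) ∂_t`. -/
theorem hasDerivAt_hpt {s : ℝ} (hs : 0 < s) (x : Fin 3 → ℝ) :
    HasDerivAt (fun σ => hpt σ x) ((s / hpt s x 0) • Pi.single 0 1) s := by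
  refine hasDerivAt_spacetime ?_ fun a => ?_
  · have h : HasDerivAt (fun σ : ℝ => σ ^ 2 + ∑ a : Fin 3, (x a) ^ 2) (2 * s) s := by
      simpa using (hasDerivAt_pow 2 s).add_const (∑ a : Fin 3, (x a) ^ 2)
    have h2 := h.sqrt (by positivity)
    simp only [hpt_zero]
    convert h2 using 1
    simp
    field_simp
  · simp only [hpt_succ]
    simpa [Fin.succ_ne_zero] using hasDerivAt_const s (x a)

/-- The tangent vector of `x ↦ hpt s x` in direction `a` is `(x^a / t) ∂_t + ∂_a`. -/
theorem hasDerivAt_hpt_line {s : ℝ} (hs : 0 < s) (x : Fin 3 → ℝ) (a : Fin 3) :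
    HasDerivAt (fun h : ℝ => hpt s (x + h • Pi.single a 1))
      ((x a / hpt s x 0) • Pi.single 0 1 + Pi.single a.succ 1) 0 := by
  have hc (b : Fin 3) : HasDerivAt (fun h : ℝ => (x + h • (Pi.single a 1 : Fin 3 → ℝ)) b)
      ((Pi.single a 1 : Fin 3 → ℝ) b) 0 := by
    simpa using ((hasDerivAt_id (0 : ℝ)).mul_const ((Pi.single a 1 : Fin 3 → ℝ) b)).const_add (x b)
  refine hasDerivAt_spacetime ?_ fun b => ?_
  · have h : HasDerivAt
        (fun h : ℝ => s ^ 2 + ∑ b : Fin 3, ((x + h • (Pi.single a 1 : Fin 3 → ℝ)) b) ^ 2)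
        (2 * x a) 0 := by
      have := (HasDerivAt.fun_sum (u := Finset.univ) fun b _ => (hc b).fun_pow 2).const_add (s ^ 2)
      refine this.congr_deriv ?_
      simp [Pi.single_apply]
    have h2 := h.sqrt (by positivity)
    simp only [hpt_zero]
    convert h2 using 1
    simp [Fin.succ_ne_zero]
    field_simp
  · simp only [hpt_succ]
    convert hc b using 1
    simp [Pi.single_apply, Fin.succ_ne_zero]

theorem hasDerivAt_comp_hpt {g : (Fin 4 → ℝ) → ℝ} (hg : Differentiable ℝ g) {s : ℝ} (hs : 0 < s)
    (x : Fin 3 → ℝ) :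
    HasDerivAt (fun σ => g (hpt σ x)) (s / hpt s x 0 * pd 0 g (hpt s x)) s := by
  simpa [pd, Function.comp_def] using
    (hg (hpt s x)).hasFDerivAt.comp_hasDerivAt s (hasDerivAt_hpt hs x)

theorem hasLineDerivAt_comp_hpt {g : (Fin 4 → ℝ) → ℝ} (hg : Differentiable ℝ g) {s : ℝ}
    (hs : 0 < s) (x : Fin 3 → ℝ) (a : Fin 3) :
    HasLineDerivAt ℝ (fun y => g (hpt s y))
      (x a / hpt s x 0 * pd 0 g (hpt s x) + pd a.succ g (hpt s x)) x (Pi.single a 1) := by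
  have h := (hg (hpt s x)).hasFDerivAt
  have h2 := HasFDerivAt.comp_hasDerivAt (f := fun h : ℝ => hpt s (x + h • Pi.single a 1)) 0
    (by simpa using h) (hasDerivAt_hpt_line hs x a)
  simpa [HasLineDerivAt, pd, Function.comp_def] using h2

/-- Families `φ s x`, continuous for `s > 0`, whose support in `x` is bounded
locally uniformly in `s`. -/
structure IsHypFamily (φ : ℝ → (Fin 3 → ℝ) → ℝ) : Prop where
  continuousOn : ContinuousOn φ.uncurry (Ioi 0 ×ˢ univ)
  eq_zero : ∀ s S x, 0 < s → s ≤ S → S ^ 2 < ‖x‖ → φ s x = 0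

namespace IsHypFamily

variable {φ φ' : ℝ → (Fin 3 → ℝ) → ℝ}

theorem continuous (h : IsHypFamily φ) {s : ℝ} (hs : 0 < s) : Continuous (φ s) := by
  rw [← continuousOn_univ]
  exact h.continuousOn.comp (f := fun x => (s, x)) (by fun_prop) fun x _ => ⟨hs, mem_univ _⟩

theorem integrable (h : IsHypFamily φ) {s : ℝ} (hs : 0 < s) : Integrable (φ s) := by
  refine (h.continuous hs).integrable_of_hasCompactSupport
    (HasCompactSupport.intro (isCompact_closedBall 0 (s ^ 2)) fun x hx => ?_)
  exact h.eq_zero s s x hs le_rfl (by simpa using hx)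

theorem add (h : IsHypFamily φ) (h' : IsHypFamily φ') :
    IsHypFamily fun s x => φ s x + φ' s x where
  continuousOn := h.continuousOn.add h'.continuousOn
  eq_zero s S x hs hS hx := by simp [h.eq_zero s S x hs hS hx, h'.eq_zero s S x hs hS hx]

theorem mul_left {a : ℝ → (Fin 3 → ℝ) → ℝ} (ha : ContinuousOn a.uncurry (Ioi 0 ×ˢ univ))
    (h : IsHypFamily φ) : IsHypFamily fun s x => a s x * φ s x where
  continuousOn := ha.mul h.continuousOn
  eq_zero s S x hs hS hx := by simp [h.eq_zero s S x hs hS hx]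

theorem sub (h : IsHypFamily φ) (h' : IsHypFamily φ') :
    IsHypFamily fun s x => φ s x - φ' s x where
  continuousOn := h.continuousOn.sub h'.continuousOn
  eq_zero s S x hs hS hx := by simp [h.eq_zero s S x hs hS hx, h'.eq_zero s S x hs hS hx]

theorem sum {ψ : Fin 3 → ℝ → (Fin 3 → ℝ) → ℝ} (h : ∀ a, IsHypFamily (ψ a)) :
    IsHypFamily fun s x => ∑ a, ψ a s x where
  continuousOn := continuousOn_finsetSum _ fun a _ => (h a).continuousOn
  eq_zero s S x hs hS hx := Finset.sum_eq_zero fun a _ => (h a).eq_zero s S x hs hS hx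

theorem continuousOn_integral (h : IsHypFamily φ) :
    ContinuousOn (fun s => ∫ x, φ s x) (Ioi 0) := by
  intro s hs
  have hs : 0 < s := hs
  have key : ContinuousOn (fun s => ∫ x, φ s x) (Ioo 0 (s + 1)) := by
    refine continuousOn_integral_of_compact_support
      (isCompact_closedBall (0 : Fin 3 → ℝ) ((s + 1) ^ 2))
      (h.continuousOn.mono (prod_mono (fun r hr => hr.1) subset_rfl)) fun r x hr hx => ?_
    exact h.eq_zero r (s + 1) x hr.1 hr.2.le (by simpa using hx)
  exact (key.continuousAt (Ioo_mem_nhds hs (by linarith))).continuousWithinAt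

theorem hasDerivAt_integral (h : IsHypFamily φ) (h' : IsHypFamily φ')
    (hd : ∀ s x, 0 < s → HasDerivAt (fun σ => φ σ x) (φ' s x) s) {s : ℝ} (hs : 0 < s) :
    HasDerivAt (fun σ => ∫ x, φ σ x) (∫ x, φ' s x) s := by
  have hK : IsCompact (Icc (s / 2) (s + 1) ×ˢ Metric.closedBall (0 : Fin 3 → ℝ) ((s + 1) ^ 2)) :=
    isCompact_Icc.prod (isCompact_closedBall _ _)
  have hpos : ∀ r ∈ Icc (s / 2) (s + 1), 0 < r := fun r hr => by linarith [hr.1]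
  obtain ⟨M, hM⟩ := hK.exists_bound_of_continuousOn
    (h'.continuousOn.mono (prod_mono (fun r hr => hpos r hr) (subset_univ _)))
  refine (hasDerivAt_integral_of_dominated_loc_of_deriv_le
    (s := Icc (s / 2) (s + 1)) (F' := φ')
    (bound := (Metric.closedBall (0 : Fin 3 → ℝ) ((s + 1) ^ 2)).indicator fun _ => M)
    (Icc_mem_nhds (by linarith) (by linarith)) ?_ (h.integrable hs)
    (h'.continuous hs).aestronglyMeasurable ?_ ?_ ?_).2
  · filter_upwards [Ioi_mem_nhds hs] with r hr
    exact (h.continuous hr).aestronglyMeasurable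
  · refine Filter.Eventually.of_forall fun x r hr => ?_
    by_cases hx : x ∈ Metric.closedBall (0 : Fin 3 → ℝ) ((s + 1) ^ 2)
    · rw [indicator_of_mem hx]
      exact hM (r, x) ⟨hr, hx⟩
    · rw [indicator_of_notMem hx, h'.eq_zero r (s + 1) x (hpos r hr) hr.2 (by simpa using hx)]
      simp
  · rw [integrable_indicator_iff measurableSet_closedBall]
    exact integrableOn_const (measure_closedBall_lt_top.ne)
  · exact Filter.Eventually.of_forall fun x r hr => hd r x (hpos r hr)

end IsHypFamily

/-- `g` vanishes for `t - 1 - δ < r`. -/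
def VanishesOutside (δ : ℝ) (g : (Fin 4 → ℝ) → ℝ) : Prop :=
  ∀ p : Fin 4 → ℝ, p 0 - 1 - δ < rad p → g p = 0

theorem VanishesOutside.pd {δ : ℝ} {g : (Fin 4 → ℝ) → ℝ} (h : VanishesOutside δ g) (i : Fin 4) :
    VanishesOutside δ (pd i g) := by
  intro p hp
  have hopen : IsOpen {q : Fin 4 → ℝ | q 0 - 1 - δ < rad q} :=
    isOpen_lt (by fun_prop) (by unfold rad; fun_prop)
  have heq : g =ᶠ[𝓝 p] fun _ => 0 := by
    filter_upwards [hopen.mem_nhds hp] with q hq using h q hq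
  simp [_root_.pd, heq.fderiv_eq]

theorem VanishesOutside.isHypFamily {δ : ℝ} (hδ : 0 < δ) {g : (Fin 4 → ℝ) → ℝ}
    (h : VanishesOutside δ g) (hg : Continuous g) : IsHypFamily fun s x => g (hpt s x) where
  continuousOn := (hg.comp continuous_hpt).continuousOn
  eq_zero s S x hs hS hx := by
    refine h _ ?_
    have hr : ‖x‖ ≤ rad (hpt s x) := by
      rw [rad_hpt]
      refine (pi_norm_le_iff_of_nonneg (Real.sqrt_nonneg _)).2 fun a => ?_
      rw [Real.norm_eq_abs]
      refine Real.abs_le_sqrt ?_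
      exact Finset.single_le_sum (f := fun a => x a ^ 2) (fun b _ => sq_nonneg _)
        (Finset.mem_univ a)
    have hrr : rad (hpt s x) ^ 2 = ∑ a, x a ^ 2 := by
      rw [rad_hpt, Real.sq_sqrt (by positivity)]
    have ht := sq_hpt_zero s x
    have hsS : s ^ 2 ≤ S ^ 2 := by gcongr
    have h0 : 0 ≤ rad (hpt s x) := Real.sqrt_nonneg _
    have : hpt s x 0 ≤ rad (hpt s x) + 1 := by
      refine (pow_le_pow_iff_left₀ (hpt_zero_pos hs x).le (by positivity) two_ne_zero).1 ?_ 
      nlinarith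
    linarith

theorem contDiff_pd {u : (Fin 4 → ℝ) → ℝ} (hu : ContDiff ℝ (⊤ : ℕ∞) u) (i : Fin 4) :
    ContDiff ℝ (⊤ : ℕ∞) (pd i u) :=
  (hu.fderiv_right (m := (⊤ : ℕ∞)) (by simp)).clm_apply contDiff_const

theorem pd_comm {u : (Fin 4 → ℝ) → ℝ} (hu : ContDiff ℝ (⊤ : ℕ∞) u) (i j : Fin 4)
    (p : Fin 4 → ℝ) : pd i (pd j u) p = pd j (pd i u) p := by
  have hd : DifferentiableAt ℝ (fderiv ℝ u) p :=
    ((hu.fderiv_right (m := (⊤ : ℕ∞)) (by simp)).differentiable (by simp)) p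
  have hval (k l : Fin 4) : pd k (pd l u) p
      = fderiv ℝ (fderiv ℝ u) p (Pi.single k 1) (Pi.single l 1) := by
    unfold pd
    rw [fderiv_clm_apply hd (differentiableAt_const _)]
    simp
  rw [hval, hval]
  exact (hu.contDiffAt.isSymmSndFDerivAt (by simpa using WithTop.coe_le_coe.2 (le_top (a := (2 : ℕ∞))))) _ _

theorem continuousOn_div_hpt {f : ℝ × (Fin 3 → ℝ) → ℝ} (hf : Continuous f) :
    ContinuousOn (fun q => f q / hpt q.1 q.2 0) (Ioi 0 ×ˢ univ) :=
  hf.continuousOn.div ((continuous_apply 0).comp continuous_hpt).continuousOn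
    fun q hq => (hpt_zero_pos hq.1 q.2).ne'

theorem integral_lineDeriv_eq_zero {g g' : (Fin 3 → ℝ) → ℝ} {v : Fin 3 → ℝ}
    (hg : Integrable g) (hg' : Integrable g') (h : ∀ x, HasLineDerivAt ℝ g (g' x) x v) :
    ∫ x, g' x = 0 := by
  simpa using integral_bilinear_hasLineDerivAt_right_eq_neg_left_of_integrable
    (μ := volume) (f := fun _ => (1 : ℝ)) (f' := fun _ => 0) (g := g) (g' := g') (v := v)
    (B := ContinuousLinearMap.mul ℝ ℝ) (by simp) (by simpa using hg') (by simpa using hg)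
    (fun x _ => by simpa [HasLineDerivAt] using hasDerivAt_const (0 : ℝ) (1 : ℝ)) (fun x _ => h x)

theorem sq_integral_mul_le {f g : (Fin 3 → ℝ) → ℝ} (hf : Integrable fun x => f x ^ 2)
    (hfg : Integrable fun x => f x * g x) (hg : Integrable fun x => g x ^ 2) :
    (∫ x, f x * g x) ^ 2 ≤ (∫ x, f x ^ 2) * ∫ x, g x ^ 2 := by
  have h : ∀ l : ℝ, 0 ≤ (∫ x, f x ^ 2) * (l * l) + (2 * ∫ x, f x * g x) * l + ∫ x, g x ^ 2 := by
    intro l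
    have h0 : 0 ≤ ∫ x, (l * f x + g x) ^ 2 := integral_nonneg fun x => sq_nonneg _
    have h1 : ∫ x, (l * f x + g x) ^ 2
        = ∫ x, (l * l * f x ^ 2 + 2 * l * (f x * g x) + g x ^ 2) := by
      congr 1; ext x; ring
    rw [h1, integral_add (by exact (hf.const_mul _).add (hfg.const_mul _)) hg,
      integral_add (hf.const_mul _) (hfg.const_mul _), integral_const_mul,
      integral_const_mul] at h0
    linarith
  have := discrim_le_zero h
  rw [discrim] at this
  nlinarith

/-- Differentiation of the flux of the vector field `(W, P)` through the hyperboloids: the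
derivative is the integral of its space-time divergence, weighted by `s / t`. -/
theorem hasDerivAt_integral_flux {δ : ℝ} (hδ : 0 < δ) {W : (Fin 4 → ℝ) → ℝ}
    {P : Fin 3 → (Fin 4 → ℝ) → ℝ} (hW : ContDiff ℝ (⊤ : ℕ∞) W)
    (hP : ∀ a, ContDiff ℝ (⊤ : ℕ∞) (P a)) (hW0 : VanishesOutside δ W)
    (hP0 : ∀ a, VanishesOutside δ (P a)) {s : ℝ} (hs : 0 < s) :
    HasDerivAt (fun σ => ∫ x, (W (hpt σ x) - ∑ a, x a / hpt σ x 0 * P a (hpt σ x)))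
      (∫ x, s / hpt s x 0 * (pd 0 W (hpt s x) + ∑ a, pd a.succ (P a) (hpt s x))) s := by
  have hr : ContinuousOn (fun q : ℝ × (Fin 3 → ℝ) => q.1 / hpt q.1 q.2 0) (Ioi 0 ×ˢ univ) :=
    continuousOn_div_hpt continuous_fst
  have hx (a : Fin 3) :
      ContinuousOn (fun q : ℝ × (Fin 3 → ℝ) => q.2 a / hpt q.1 q.2 0) (Ioi 0 ×ˢ univ) :=
    continuousOn_div_hpt (by fun_prop)
  have hinv : ContinuousOn (fun q : ℝ × (Fin 3 → ℝ) => 1 / hpt q.1 q.2 0) (Ioi 0 ×ˢ univ) :=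
    continuousOn_div_hpt continuous_const
  have fW := hW0.isHypFamily hδ hW.continuous
  have fP (a : Fin 3) := (hP0 a).isHypFamily hδ (hP a).continuous
  have fWt := (hW0.pd 0).isHypFamily hδ (contDiff_pd hW 0).continuous
  have fPd (a : Fin 3) (i : Fin 4) :=
    ((hP0 a).pd i).isHypFamily hδ (contDiff_pd (hP a) i).continuous
  have fφ := fW.sub (IsHypFamily.sum fun a => (fP a).mul_left
    (a := fun s x => x a / hpt s x 0) (hx a))
  have fdiv := (fWt.add (IsHypFamily.sum fun a => fPd a a.succ)).mul_left
    (a := fun s x => s / hpt s x 0) hr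
  have fG (a : Fin 3) := (fP a).mul_left (a := fun s x => s / hpt s x 0) hr
  have fDG (a : Fin 3) : IsHypFamily fun s x =>
      -(s / hpt s x 0 * (x a / hpt s x 0) * (1 / hpt s x 0)) * P a (hpt s x)
        + s / hpt s x 0 * (x a / hpt s x 0 * pd 0 (P a) (hpt s x)
          + pd a.succ (P a) (hpt s x)) :=
    ((fP a).mul_left
        (a := fun s x => -(s / hpt s x 0 * (x a / hpt s x 0) * (1 / hpt s x 0)))
        ((hr.mul (hx a)).mul hinv).neg).add
      ((((fPd a 0).mul_left (a := fun s x => x a / hpt s x 0) (hx a)).add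
        (fPd a a.succ)).mul_left (a := fun s x => s / hpt s x 0) hr)
  have hpt0 : Differentiable ℝ fun p : Fin 4 → ℝ => p 0 := by fun_prop
  have pd0 (p : Fin 4 → ℝ) (i : Fin 4) :
      pd i (fun q => q 0) p = (Pi.single i 1 : Fin 4 → ℝ) 0 := by
    have : HasFDerivAt (fun q : Fin 4 → ℝ => q 0)
      (ContinuousLinearMap.proj (R := ℝ) (φ := fun _ : Fin 4 => ℝ) 0) p :=
      (ContinuousLinearMap.proj (R := ℝ) (φ := fun _ : Fin 4 => ℝ) 0).hasFDerivAt
    simp [pd, this.fderiv]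
  have hDG (a : Fin 3) {s : ℝ} (hs : 0 < s) : ∫ x,
      (-(s / hpt s x 0 * (x a / hpt s x 0) * (1 / hpt s x 0)) * P a (hpt s x)
        + s / hpt s x 0 * (x a / hpt s x 0 * pd 0 (P a) (hpt s x)
          + pd a.succ (P a) (hpt s x))) = 0 := by
    refine integral_lineDeriv_eq_zero ((fG a).integrable hs) ((fDG a).integrable hs)
      (v := Pi.single a 1) fun x => ?_
    have h1 := hasLineDerivAt_comp_hpt hpt0 hs x a
    have h2 := hasLineDerivAt_comp_hpt ((hP a).differentiable (by simp)) hs x a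
    have hne : hpt s x 0 ≠ 0 := (hpt_zero_pos hs x).ne'
    unfold HasLineDerivAt at h1 h2 ⊢
    refine (((hasDerivAt_const (0 : ℝ) s).fun_div h1 (by simpa using hne)).fun_mul
      h2).congr_deriv ?_
    simp [pd0, Fin.succ_ne_zero]
    field_simp
  have hd (s : ℝ) (x : Fin 3 → ℝ) (hs : 0 < s) :
      HasDerivAt (fun σ => W (hpt σ x) - ∑ a, x a / hpt σ x 0 * P a (hpt σ x))
        (s / hpt s x 0 * (pd 0 W (hpt s x) + ∑ a, pd a.succ (P a) (hpt s x))
          - ∑ a, (-(s / hpt s x 0 * (x a / hpt s x 0) * (1 / hpt s x 0)) * P a (hpt s x)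
            + s / hpt s x 0 * (x a / hpt s x 0 * pd 0 (P a) (hpt s x)
              + pd a.succ (P a) (hpt s x)))) s := by
    have hne : hpt s x 0 ≠ 0 := (hpt_zero_pos hs x).ne'
    have h1 := hasDerivAt_comp_hpt hpt0 hs x
    have hW1 := hasDerivAt_comp_hpt (hW.differentiable (by simp)) hs x
    have hP1 (a : Fin 3) := hasDerivAt_comp_hpt ((hP a).differentiable (by simp)) hs x
    refine (hW1.fun_sub (HasDerivAt.fun_sum (u := Finset.univ) fun a _ =>
      ((hasDerivAt_const s (x a)).fun_div h1 hne).fun_mul (hP1 a))).congr_deriv ?_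
    simp only [pd0, mul_add, Finset.mul_sum, sub_eq_add_neg, add_assoc,
      ← Finset.sum_neg_distrib, ← Finset.sum_add_distrib]
    congr 1
    refine Finset.sum_congr rfl fun a _ => ?_
    simp
    field_simp
    ring
  have key := fφ.hasDerivAt_integral (fdiv.sub (IsHypFamily.sum fDG)) hd hs
  rw [integral_sub (fdiv.integrable hs) ((IsHypFamily.sum fDG).integrable hs),
    integral_finsetSum _ fun a _ => (fDG a).integrable hs,
    Finset.sum_eq_zero fun a _ => hDG a hs, sub_zero] at key
  exact key

section Energy

variable {u : (Fin 4 → ℝ) → ℝ}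

/-- The energy density `e_c` controls `((s/t) ∂_t u)²`. -/
theorem sq_mul_pd_le_density (c : ℝ) (u : (Fin 4 → ℝ) → ℝ) {s : ℝ} (hs : 0 < s)
    (x : Fin 3 → ℝ) :
    (s / hpt s x 0 * pd 0 u (hpt s x)) ^ 2 ≤
      (pd 0 u (hpt s x)) ^ 2 + (∑ a : Fin 3, (pd a.succ u (hpt s x)) ^ 2)
        + 2 * (∑ a : Fin 3, (x a / hpt s x 0) * pd 0 u (hpt s x) * pd a.succ u (hpt s x))
        + c ^ 2 * (u (hpt s x)) ^ 2 := by
  have hne : hpt s x 0 ≠ 0 := (hpt_zero_pos hs x).ne'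
  have hone : (s / hpt s x 0) ^ 2 + ∑ a, (x a / hpt s x 0) ^ 2 = 1 := by
    simp only [div_pow, ← Finset.sum_div, ← add_div]
    rw [← sq_hpt_zero, div_self (pow_ne_zero 2 hne)]
  have hsq : 0 ≤ (∑ a : Fin 3, (x a / hpt s x 0 * pd 0 u (hpt s x)
      + pd a.succ u (hpt s x)) ^ 2) + (c * u (hpt s x)) ^ 2 := by positivity
  simp only [Fin.sum_univ_three] at hone hsq ⊢
  generalize s / hpt s x 0 = r at *
  linear_combination hsq + (pd 0 u (hpt s x)) ^ 2 * hone

theorem differentiable_pd (hu : ContDiff ℝ (⊤ : ℕ∞) u) (i : Fin 4) : Differentiable ℝ (pd i u) :=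
  (contDiff_pd hu i).differentiable (by simp)

/-- Divergence form of the product of `2 ∂_t u` with the Klein-Gordon operator. -/
theorem divergence_identity (hu : ContDiff ℝ (⊤ : ℕ∞) u) (c : ℝ) (p : Fin 4 → ℝ) :
    pd 0 (fun q => (pd 0 u q) ^ 2 + (∑ a : Fin 3, (pd a.succ u q) ^ 2) + c ^ 2 * (u q) ^ 2) p
      + ∑ a : Fin 3, pd a.succ (fun q => -2 * (pd 0 u q * pd a.succ u q)) p
      = 2 * pd 0 u p * (box u p + c ^ 2 * u p) := by
  have h (i : Fin 4) := (differentiable_pd hu i p).hasFDerivAt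
  have h0 := (hu.differentiable (by simp) p).hasFDerivAt
  have hWd : HasFDerivAt (fun q => (pd 0 u q) ^ 2 + (∑ a : Fin 3, (pd a.succ u q) ^ 2)
      + c ^ 2 * (u q) ^ 2) _ p := (((h 0).pow 2).fun_add (HasFDerivAt.fun_sum (u := Finset.univ)
    fun (a : Fin 3) _ => (h a.succ).pow 2)).fun_add ((h0.pow 2).const_mul (c ^ 2))
  have hPd (a : Fin 3) := ((h 0).fun_mul (h a.succ)).const_mul (-2)
  have e1 : pd 0 (fun q => (pd 0 u q) ^ 2 + (∑ a : Fin 3, (pd a.succ u q) ^ 2)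
      + c ^ 2 * (u q) ^ 2) p = 2 * pd 0 u p * pd 0 (pd 0 u) p
        + (∑ a : Fin 3, 2 * pd a.succ u p * pd 0 (pd a.succ u) p)
        + c ^ 2 * (2 * u p * pd 0 u p) := by
    rw [pd, hWd.fderiv]
    simp [pd]
  have e2 (a : Fin 3) : pd a.succ (fun q => -2 * (pd 0 u q * pd a.succ u q)) p
      = -2 * (pd 0 u p * pd a.succ (pd a.succ u) p
        + pd a.succ u p * pd a.succ (pd 0 u) p) := by
    rw [pd, (hPd a).fderiv]
    simp [pd]
    ring
  rw [e1, Finset.sum_congr rfl fun a _ => e2 a]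
  simp only [fun a : Fin 3 => pd_comm hu 0 a.succ p, box, Fin.sum_univ_three]
  ring

theorem hasDerivAt_Ec (hu : ContDiff ℝ (⊤ : ℕ∞) u) {δ : ℝ} (hδ : 0 < δ)
    (h0 : VanishesOutside δ u) (c : ℝ) {s : ℝ} (hs : 0 < s) :
    HasDerivAt (fun σ => Ec c σ u)
      (2 * ∫ x, (s / hpt s x 0 * pd 0 u (hpt s x))
        * (box u (hpt s x) + c ^ 2 * u (hpt s x))) s := by
  have hpd := contDiff_pd hu
  have key := hasDerivAt_integral_flux hδ
    (W := fun q => (pd 0 u q) ^ 2 + (∑ a : Fin 3, (pd a.succ u q) ^ 2) + c ^ 2 * (u q) ^ 2)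
    (P := fun a q => -2 * (pd 0 u q * pd a.succ u q)) (by fun_prop) (fun a => by fun_prop)
    (fun p hp => by simp [h0 p hp, h0.pd _ p hp]) (fun a p hp => by simp [h0.pd _ p hp]) hs
  have hE : (fun σ => Ec c σ u) = fun σ => ∫ x,
      ((pd 0 u (hpt σ x)) ^ 2 + (∑ a : Fin 3, (pd a.succ u (hpt σ x)) ^ 2)
        + c ^ 2 * (u (hpt σ x)) ^ 2
        - ∑ a, x a / hpt σ x 0 * (-2 * (pd 0 u (hpt σ x) * pd a.succ u (hpt σ x)))) := by
    funext σ
    refine integral_congr_ae (Filter.Eventually.of_forall fun x => ?_)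
    simp only [Fin.sum_univ_three]
    ring
  rw [hE, ← integral_const_mul]
  refine key.congr_deriv (integral_congr_ae (Filter.Eventually.of_forall fun x => ?_))
  dsimp only
  rw [divergence_identity hu]
  ring

end Energy

theorem contDiff_box {u : (Fin 4 → ℝ) → ℝ} (hu : ContDiff ℝ (⊤ : ℕ∞) u) :
    ContDiff ℝ (⊤ : ℕ∞) (box u) := by
  have h (i : Fin 4) := contDiff_pd (contDiff_pd hu i) i
  unfold box
  fun_prop

theorem VanishesOutside.box {δ : ℝ} {u : (Fin 4 → ℝ) → ℝ} (h : VanishesOutside δ u) :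
    VanishesOutside δ (box u) := fun p hp => by
  simp [_root_.box, (h.pd _).pd _ p hp]

theorem sqrt_le_of_deriv_le {E E' L : ℝ → ℝ} {a b : ℝ} (ha : 0 < a) (hab : a ≤ b)
    (hE : ∀ s, 0 < s → 0 ≤ E s) (hE' : ∀ s, 0 < s → HasDerivAt E (E' s) s)
    (hL : ContinuousOn L (Ioi 0)) (hL0 : ∀ s, 0 ≤ L s)
    (hbound : ∀ s, 0 < s → E' s ≤ 2 * (Real.sqrt (E s) * L s)) :
    Real.sqrt (E b) ≤ Real.sqrt (E a) + ∫ τ in a..b, L τ := by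
  refine le_of_forall_pos_le_add fun η hη => ?_
  have hpos : ∀ s ∈ Icc a b, 0 < s := fun s hs => ha.trans_le hs.1
  have hder (s : ℝ) (hs : 0 < s) : HasDerivAt (fun σ => Real.sqrt (E σ + η ^ 2))
      (E' s / (2 * Real.sqrt (E s + η ^ 2))) s :=
    ((hE' s hs).add_const _).sqrt (by have := hE s hs; positivity)
  have hint (s : ℝ) (hs : a ≤ s) : IntervalIntegrable L volume a s :=
    (hL.mono fun r hr => ha.trans_le (by rw [uIcc_of_le hs] at hr; exact hr.1)).intervalIntegrable
  have hBder (s : ℝ) (hs : a ≤ s) : HasDerivAt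
      (fun σ => Real.sqrt (E a + η ^ 2) + ∫ τ in a..σ, L τ) (L s) s :=
    (intervalIntegral.integral_hasDerivAt_right (hint s hs)
      (hL.stronglyMeasurableAtFilter isOpen_Ioi s (ha.trans_le hs))
      (hL.continuousAt (Ioi_mem_nhds (ha.trans_le hs)))).const_add _
  have key := image_le_of_deriv_right_le_deriv_boundary
    (f := fun σ => Real.sqrt (E σ + η ^ 2)) (a := a) (b := b)
    (fun s hs => (hder s (hpos s hs)).continuousAt.continuousWithinAt)
    (fun s hs => (hder s (hpos s (Ico_subset_Icc_self hs))).hasDerivWithinAt)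
    (B := fun σ => Real.sqrt (E a + η ^ 2) + ∫ τ in a..σ, L τ) (by simp)
    (fun s hs => (hBder s hs.1).continuousAt.continuousWithinAt)
    (fun s hs => (hBder s hs.1).hasDerivWithinAt)
    (fun s hs => by
      have hs0 := hpos s (Ico_subset_Icc_self hs)
      have hEs := hE s hs0
      rw [div_le_iff₀ (by positivity)]
      have h1 : Real.sqrt (E s) ≤ Real.sqrt (E s + η ^ 2) :=
        Real.sqrt_le_sqrt (by linarith [sq_nonneg η])
      nlinarith [hbound s hs0, mul_le_mul_of_nonneg_right h1 (hL0 s)])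
    (right_mem_Icc.2 hab)
  have h1 : Real.sqrt (E b) ≤ Real.sqrt (E b + η ^ 2) :=
    Real.sqrt_le_sqrt (by linarith [sq_nonneg η])
  have h2 : Real.sqrt (E a + η ^ 2) ≤ Real.sqrt (E a) + η := by
    rw [Real.sqrt_le_left (by positivity)]
    nlinarith [Real.sq_sqrt (hE a ha), Real.sqrt_nonneg (E a)]
  linarith

/-- Hyperboloidal standard energy estimate. -/
theorem stmt_1 : ∃ C > (0:ℝ), ∀ (c s₀ s₁ : ℝ), 0 ≤ c → 2 ≤ s₀ → s₀ ≤ s₁ →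
    ∀ u : (Fin 4 → ℝ) → ℝ, ContDiff ℝ (⊤ : ℕ∞) u → vanishNearBdry u →
      ∀ s ∈ Set.Icc s₀ s₁,
        Real.sqrt (Ec c s u)
          ≤ Real.sqrt (Ec c s₀ u)
            + C * ∫ τ in s₀..s, L2f τ (fun p => box u p + c ^ 2 * u p) := by
  refine ⟨1, one_pos, fun c s₀ s₁ _ hs₀ _ u hu hvan s hs => ?_⟩
  obtain ⟨δ, hδ, hvan⟩ := hvan
  have h0 : VanishesOutside δ u := fun p hp => hvan p hp.le
  have hF : ContDiff ℝ (⊤ : ℕ∞) fun p => box u p + c ^ 2 * u p := by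
    have := contDiff_box hu
    fun_prop
  have hF0 : VanishesOutside δ fun p => box u p + c ^ 2 * u p := fun p hp => by
    simp [h0 p hp, h0.box p hp]
  have hr : ContinuousOn (fun q : ℝ × (Fin 3 → ℝ) => q.1 / hpt q.1 q.2 0) (Ioi 0 ×ˢ univ) :=
    continuousOn_div_hpt continuous_fst
  have fF := hF0.isHypFamily hδ hF.continuous
  have ff := ((h0.pd 0).isHypFamily hδ (contDiff_pd hu 0).continuous).mul_left
    (a := fun s x => s / hpt s x 0) hr
  have fFF := fF.mul_left fF.continuousOn
  have fff := ff.mul_left ff.continuousOn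
  have ffF := fF.mul_left ff.continuousOn
  simp only [← sq] at fFF fff
  have hle {σ : ℝ} (hσ : 0 < σ) :
      ∫ x, (σ / hpt σ x 0 * pd 0 u (hpt σ x)) ^ 2 ≤ Ec c σ u := by
    refine integral_mono (fff.integrable hσ) ?_ fun x => sq_mul_pd_le_density c u hσ x
    have hpd (i : Fin 4) := (h0.pd i).isHypFamily hδ (contDiff_pd hu i).continuous
    have hpd2 (i : Fin 4) := (hpd i).mul_left (hpd i).continuousOn
    have hu0 := h0.isHypFamily hδ hu.continuous
    have hx (a : Fin 3) :
        ContinuousOn (fun q : ℝ × (Fin 3 → ℝ) => q.2 a / hpt q.1 q.2 0) (Ioi 0 ×ˢ univ) :=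
      continuousOn_div_hpt (by fun_prop)
    have hfam := (((hpd2 0).add (IsHypFamily.sum fun a => hpd2 a.succ)).add
      ((IsHypFamily.sum fun a => (hpd a.succ).mul_left
        (a := fun s x => x a / hpt s x 0 * pd 0 u (hpt s x)) ((hx a).mul (hpd 0).continuousOn)).mul_left
        (a := fun _ _ => 2) continuousOn_const)).add
      ((hu0.mul_left hu0.continuousOn).mul_left (a := fun _ _ => c ^ 2) continuousOn_const)
    simp only [← sq] at hfam
    exact hfam.integrable hσ
  have hEnn (σ : ℝ) (hσ : 0 < σ) : 0 ≤ Ec c σ u :=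
    (integral_nonneg fun x => sq_nonneg _).trans (hle hσ)
  rw [one_mul]
  refine sqrt_le_of_deriv_le (by linarith) hs.1 hEnn (fun σ hσ => hasDerivAt_Ec hu hδ h0 c hσ)
    fFF.continuousOn_integral.sqrt (fun σ => Real.sqrt_nonneg _) fun σ hσ => ?_
  have hcs := sq_integral_mul_le (fff.integrable hσ) (ffF.integrable hσ) (fFF.integrable hσ)
  rw [L2f, ← Real.sqrt_mul (hEnn σ hσ)]
  gcongr
  refine Real.le_sqrt_of_sq_le (hcs.trans ?_)
  exact mul_le_mul_of_nonneg_right (hle hσ) (integral_nonneg fun x => sq_nonneg _)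
end
end

section
/- Hyperboloidal conformal energy estimate: There is a universal constant C > 0 such that for all 2 ≤ s₀ ≤ s₁ and every smooth function u defined on K_{[s₀,s₁]} vanishing on a neighborhood of the boundary {r = t−1}, one has for all s ∈ [s₀,s₁]: E_con(s,u)^{1/2} ≤ E_con(s₀,u)^{1/2} + C ∫_{s₀}^{s} τ ‖□u‖_{L²_f(H_τ)} dτ. -/
noncomputable section
open MeasureTheory

open scoped ContDiff Topology

theorem pd_add {i : Fin 4} {f g : (Fin 4 → ℝ) → ℝ} {q : Fin 4 → ℝ}
    (hf : DifferentiableAt ℝ f q) (hg : DifferentiableAt ℝ g q) :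
    pd i (fun p => f p + g p) q = pd i f q + pd i g q := by
  simp [pd, fderiv_fun_add hf hg]

theorem pd_sub {i : Fin 4} {f g : (Fin 4 → ℝ) → ℝ} {q : Fin 4 → ℝ}
    (hf : DifferentiableAt ℝ f q) (hg : DifferentiableAt ℝ g q) :
    pd i (fun p => f p - g p) q = pd i f q - pd i g q := by
  simp [pd, fderiv_fun_sub hf hg]

theorem pd_mul {i : Fin 4} {f g : (Fin 4 → ℝ) → ℝ} {q : Fin 4 → ℝ}
    (hf : DifferentiableAt ℝ f q) (hg : DifferentiableAt ℝ g q) :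
    pd i (fun p => f p * g p) q = f q * pd i g q + g q * pd i f q := by
  simp [pd, fderiv_fun_mul hf hg]

theorem pd_const {i : Fin 4} {c : ℝ} {q : Fin 4 → ℝ} : pd i (fun _ => c) q = 0 := by
  simp [pd]

theorem pd_coord {i j : Fin 4} {q : Fin 4 → ℝ} :
    pd i (fun p => p j) q = if j = i then 1 else 0 := by
  simp [pd, fderiv_apply, Pi.single_apply]

theorem pd_congr {i : Fin 4} {f g : (Fin 4 → ℝ) → ℝ} {q : Fin 4 → ℝ} (h : f =ᶠ[𝓝 q] g) :
    pd i f q = pd i g q := by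
  simp [pd, h.fderiv_eq]

theorem ContDiffAt.pd {i : Fin 4} {f : (Fin 4 → ℝ) → ℝ} {q : Fin 4 → ℝ}
    (h : ContDiffAt ℝ ∞ f q) : ContDiffAt ℝ ∞ (pd i f) q :=
  (h.fderiv_right (m := ∞) (by simp)).clm_apply contDiffAt_const

theorem pd_comm_s2 {i j : Fin 4} {f : (Fin 4 → ℝ) → ℝ} {q : Fin 4 → ℝ}
    (h : ContDiffAt ℝ ∞ f q) : pd i (pd j f) q = pd j (pd i f) q := by
  have hd : DifferentiableAt ℝ (fderiv ℝ f) q :=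
    (h.fderiv_right (m := ∞) (by simp)).differentiableAt (by simp)
  have key : ∀ k l : Fin 4, pd k (pd l f) q
      = fderiv ℝ (fderiv ℝ f) q (Pi.single k 1) (Pi.single l 1) := by
    intro k l
    change fderiv ℝ (fun p => fderiv ℝ f p (Pi.single l 1)) q (Pi.single k 1) = _
    rw [fderiv_clm_apply hd (differentiableAt_const _)]
    simp
  rw [key, key]
  have h2 : (2 : WithTop ℕ∞) ≤ ∞ := WithTop.coe_le_coe.2 (le_top : (2 : ℕ∞) ≤ ⊤)
  exact (h.isSymmSndFDerivAt (by simpa using h2)).eq _ _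

/-- Smooth functions of hyperboloidal coordinates `(s, x)`, `s > 0`, supported in `|x| ≤ s²`. -/
structure ConeSupported (G : (Fin 4 → ℝ) → ℝ) : Prop where
  contDiffAt : ∀ q : Fin 4 → ℝ, 0 < q 0 → ContDiffAt ℝ ∞ G q
  eq_zero : ∀ q : Fin 4 → ℝ, 0 < q 0 → q 0 ^ 2 < ‖Fin.tail q‖ → G q = 0

namespace ConeSupported

variable {F G : (Fin 4 → ℝ) → ℝ}

theorem differentiableAt (hG : ConeSupported G) {q : Fin 4 → ℝ} (hq : 0 < q 0) :
    DifferentiableAt ℝ G q :=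
  (hG.contDiffAt q hq).differentiableAt (by simp)

protected theorem pd (hG : ConeSupported G) (i : Fin 4) : ConeSupported (pd i G) where
  contDiffAt q hq := (hG.contDiffAt q hq).pd
  eq_zero q hq hq' := by
    have ho : IsOpen {p : Fin 4 → ℝ | 0 < p 0 ∧ p 0 ^ 2 < ‖Fin.tail p‖} := by
      have ht : Continuous fun p : Fin 4 → ℝ => (Fin.tail p : Fin 3 → ℝ) :=
        continuous_pi fun i => continuous_apply i.succ
      exact (isOpen_lt continuous_const (continuous_apply 0)).inter
        (isOpen_lt ((continuous_apply 0).pow 2) ht.norm)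
    have : G =ᶠ[𝓝 q] fun _ => 0 := by
      filter_upwards [ho.mem_nhds ⟨hq, hq'⟩] with p hp using hG.eq_zero p hp.1 hp.2
    rw [pd_congr this, pd_const]

theorem add (hF : ConeSupported F) (hG : ConeSupported G) :
    ConeSupported (fun q => F q + G q) where
  contDiffAt q hq := (hF.contDiffAt q hq).add (hG.contDiffAt q hq)
  eq_zero q hq hq' := by simp [hF.eq_zero q hq hq', hG.eq_zero q hq hq']

theorem sub (hF : ConeSupported F) (hG : ConeSupported G) :
    ConeSupported (fun q => F q - G q) where
  contDiffAt q hq := (hF.contDiffAt q hq).sub (hG.contDiffAt q hq)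
  eq_zero q hq hq' := by simp [hF.eq_zero q hq hq', hG.eq_zero q hq hq']

theorem smooth_mul (hF : ∀ q : Fin 4 → ℝ, 0 < q 0 → ContDiffAt ℝ ∞ F q) (hG : ConeSupported G) :
    ConeSupported (fun q => F q * G q) where
  contDiffAt q hq := (hF q hq).mul (hG.contDiffAt q hq)
  eq_zero q hq hq' := by simp [hG.eq_zero q hq hq']

theorem mul (hF : ConeSupported F) (hG : ConeSupported G) :
    ConeSupported (fun q => F q * G q) :=
  smooth_mul hF.contDiffAt hG

theorem const_mul (c : ℝ) (hG : ConeSupported G) : ConeSupported (fun q => c * G q) :=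
  smooth_mul (fun _ _ => contDiffAt_const) hG

theorem coord_mul (i : Fin 4) (hG : ConeSupported G) : ConeSupported (fun q => q i * G q) :=
  smooth_mul (fun _ _ => contDiffAt_apply ℝ ℝ i _) hG

theorem continuous_slice (hG : ConeSupported G) {s : ℝ} (hs : 0 < s) :
    Continuous fun x : Fin 3 → ℝ => G (Fin.cons s x) := by
  refine continuous_iff_continuousAt.2 fun x => ?_
  refine ContinuousAt.comp (g := G) (f := fun x : Fin 3 → ℝ => (Fin.cons s x : Fin 4 → ℝ))
    (hG.contDiffAt (Fin.cons s x) (by simpa using hs)).continuousAt ?_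
  fun_prop

theorem hasCompactSupport_slice (hG : ConeSupported G) {s : ℝ} (hs : 0 < s) :
    HasCompactSupport fun x : Fin 3 → ℝ => G (Fin.cons s x) := by
  refine HasCompactSupport.intro (isCompact_closedBall (0 : Fin 3 → ℝ) (s ^ 2)) fun x hx => ?_
  exact hG.eq_zero _ (by simpa using hs) (by simpa using hx)

theorem integrable_slice (hG : ConeSupported G) {s : ℝ} (hs : 0 < s) :
    Integrable fun x : Fin 3 → ℝ => G (Fin.cons s x) :=
  (hG.continuous_slice hs).integrable_of_hasCompactSupport (hG.hasCompactSupport_slice hs)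

theorem hasFDerivAt_slice (hG : ConeSupported G) {s : ℝ} (hs : 0 < s) (x : Fin 3 → ℝ) :
    HasFDerivAt (fun x : Fin 3 → ℝ => G (Fin.cons s x))
      ((fderiv ℝ G (Fin.cons s x)).comp
        (ContinuousLinearMap.pi
          (Fin.cons 0 fun a => ContinuousLinearMap.proj a : Fin 4 → ((Fin 3 → ℝ) →L[ℝ] ℝ)))) x := by
  refine HasFDerivAt.comp x (f := fun x : Fin 3 → ℝ => (Fin.cons s x : Fin 4 → ℝ))
    (hG.differentiableAt (q := Fin.cons s x) (by simpa using hs)).hasFDerivAt ?_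
  refine hasFDerivAt_pi.2 fun i => ?_
  refine Fin.cases ?_ (fun a => ?_) i
  · simpa using hasFDerivAt_const s x
  · simpa using hasFDerivAt_apply a x

theorem integral_pd_succ (hG : ConeSupported G) {s : ℝ} (hs : 0 < s) (a : Fin 3) :
    ∫ x : Fin 3 → ℝ, pd a.succ G (Fin.cons s x) = 0 := by
  have h1 : ∀ x : Fin 3 → ℝ, fderiv ℝ (fun x : Fin 3 → ℝ => G (Fin.cons s x)) x (Pi.single a 1)
      = pd a.succ G (Fin.cons s x) := by
    intro x
    rw [(hG.hasFDerivAt_slice hs x).fderiv, pd, ContinuousLinearMap.comp_apply]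
    congr 1
    ext i
    refine Fin.cases ?_ (fun b => ?_) i
    · simp
    · simp [Pi.single_apply]
  simp_rw [← h1]
  have := integral_mul_fderiv_eq_neg_fderiv_mul_of_integrable (μ := (volume : Measure (Fin 3 → ℝ)))
    (f := fun _ => (1 : ℝ)) (g := fun x : Fin 3 → ℝ => G (Fin.cons s x)) (v := Pi.single a 1)
    (by simp) (by simpa only [one_mul, h1] using (hG.pd a.succ).integrable_slice hs)
    (by simpa using hG.integrable_slice hs) (by simp)
    (fun x _ => (hG.hasFDerivAt_slice hs x).differentiableAt)
  simpa using this

theorem hasDerivAt_integral (hG : ConeSupported G) {s : ℝ} (hs : 0 < s) :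
    HasDerivAt (fun τ => ∫ x : Fin 3 → ℝ, G (Fin.cons τ x))
      (∫ x : Fin 3 → ℝ, pd 0 G (Fin.cons s x)) s := by
  have hpos : ∀ τ ∈ Set.Icc (s / 2) (2 * s), 0 < τ := fun τ hτ => by linarith [hτ.1]
  obtain ⟨C, hC⟩ := ((isCompact_Icc (a := s / 2) (b := 2 * s)).prod
    (isCompact_closedBall (0 : Fin 3 → ℝ) ((2 * s) ^ 2))).exists_bound_of_continuousOn
    (f := fun z : ℝ × (Fin 3 → ℝ) => pd 0 G (Fin.cons z.1 z.2)) (by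
      intro z hz
      refine ContinuousAt.continuousWithinAt ?_
      refine ContinuousAt.comp (g := pd 0 G)
        (f := fun z : ℝ × (Fin 3 → ℝ) => (Fin.cons z.1 z.2 : Fin 4 → ℝ))
        ((hG.pd 0).contDiffAt (Fin.cons z.1 z.2)
          (by simpa using hpos z.1 hz.1)).continuousAt ?_
      fun_prop)
  have hnhds : Set.Icc (s / 2) (2 * s) ∈ 𝓝 s := Icc_mem_nhds (by linarith) (by linarith)
  refine (hasDerivAt_integral_of_dominated_loc_of_deriv_le (μ := volume)
    (F := fun τ x => G (Fin.cons τ x)) (F' := fun τ x => pd 0 G (Fin.cons τ x))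
    (bound := (Metric.closedBall (0 : Fin 3 → ℝ) ((2 * s) ^ 2)).indicator fun _ => C)
    hnhds ?_ (hG.integrable_slice hs)
    ((hG.pd 0).continuous_slice hs).aestronglyMeasurable ?_ ?_ ?_).2
  · filter_upwards [hnhds] with τ hτ
    exact (hG.continuous_slice (hpos τ hτ)).aestronglyMeasurable
  · refine Filter.Eventually.of_forall fun x τ hτ => ?_
    by_cases hx : x ∈ Metric.closedBall (0 : Fin 3 → ℝ) ((2 * s) ^ 2)
    · rw [Set.indicator_of_mem hx]
      exact hC (τ, x) ⟨hτ, hx⟩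
    · rw [Set.indicator_of_notMem hx, (hG.pd 0).eq_zero _ (by simpa using hpos τ hτ), norm_zero]
      have h1 : (2 * s) ^ 2 < ‖x‖ := by simpa using hx
      have h2 : τ ^ 2 ≤ (2 * s) ^ 2 := pow_le_pow_left₀ (hpos τ hτ).le hτ.2 2
      simpa using h2.trans_lt h1
  · exact (integrable_indicator_iff Metric.isClosed_closedBall.measurableSet).2
      (integrableOn_const (isCompact_closedBall _ _).measure_lt_top.ne)
  · refine Filter.Eventually.of_forall fun x τ hτ => ?_
    refine (hG.differentiableAt (q := Fin.cons τ x)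
      (by simpa using hpos τ hτ)).hasFDerivAt.comp_hasDerivAt τ
      (f := fun τ => (Fin.cons τ x : Fin 4 → ℝ)) ?_
    refine hasDerivAt_pi.2 fun i => ?_
    refine Fin.cases ?_ (fun a => ?_) i
    · simpa using hasDerivAt_id' τ
    · simpa using hasDerivAt_const τ (x a)

end ConeSupported

/-- The change of variables `(s, x) ↦ (√(s² + |x|²), x)`. -/
def hypMap (q : Fin 4 → ℝ) : Fin 4 → ℝ := hpt (q 0) (Fin.tail q)

theorem hypMap_cons (s : ℝ) (x : Fin 3 → ℝ) : hypMap (Fin.cons s x) = hpt s x := by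
  simp [hypMap]

theorem hypMap_succ (q : Fin 4 → ℝ) (a : Fin 3) : hypMap q a.succ = q a.succ := by
  simp [hypMap, hpt, Fin.tail]

theorem hypMap_zero (q : Fin 4 → ℝ) :
    hypMap q 0 = √(q 0 ^ 2 + ∑ a : Fin 3, q a.succ ^ 2) := by
  simp [hypMap, hpt, Fin.tail]

theorem hypMap_zero_sq (q : Fin 4 → ℝ) :
    hypMap q 0 ^ 2 = q 0 ^ 2 + ∑ a : Fin 3, q a.succ ^ 2 := by
  rw [hypMap_zero, Real.sq_sqrt (by positivity)]

theorem hypMap_zero_pos {q : Fin 4 → ℝ} (hq : 0 < q 0) : 0 < hypMap q 0 := by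
  rw [hypMap_zero]
  positivity

theorem contDiffAt_hypMap {q : Fin 4 → ℝ} (hq : 0 < q 0) : ContDiffAt ℝ ∞ hypMap q := by
  refine contDiffAt_pi.2 fun i => ?_
  refine Fin.cases ?_ (fun a => ?_) i
  · simp_rw [hypMap_zero]
    refine ContDiffAt.sqrt ?_ (by positivity)
    fun_prop
  · simp_rw [hypMap_succ]
    fun_prop

theorem pd_hypMap_zero {q : Fin 4 → ℝ} (hq : 0 < q 0) (i : Fin 4) :
    pd i (fun p => hypMap p 0) q = q i / hypMap q 0 := by
  have hd : DifferentiableAt ℝ (fun p => hypMap p 0) q :=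
    (contDiffAt_pi.1 (contDiffAt_hypMap hq) 0).differentiableAt (by simp)
  have h : pd i (fun p => hypMap p 0 * hypMap p 0) q = 2 * q i := by
    have : (fun p => hypMap p 0 * hypMap p 0)
        = fun p => p 0 * p 0 + (p 1 * p 1 + p 2 * p 2 + p 3 * p 3) := by
      funext p
      rw [← sq, hypMap_zero_sq, Fin.sum_univ_three]
      simp only [Fin.succ_zero_eq_one, Fin.succ_one_eq_two, Fin.reduceSucc]
      ring
    rw [this]
    simp (disch := fun_prop) only [pd_add, pd_mul, pd_coord]
    fin_cases i <;> simp <;> ring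
  rw [pd_mul hd hd] at h
  rw [eq_div_iff (hypMap_zero_pos hq).ne']
  linarith

theorem pd_comp_hypMap {g : (Fin 4 → ℝ) → ℝ} {q : Fin 4 → ℝ} (hq : 0 < q 0)
    (hg : DifferentiableAt ℝ g (hypMap q)) (i : Fin 4) :
    pd i (fun p => g (hypMap p)) q
      = q i / hypMap q 0 * pd 0 g (hypMap q) + if i = 0 then 0 else pd i g (hypMap q) := by
  have hd : DifferentiableAt ℝ hypMap q := (contDiffAt_hypMap hq).differentiableAt (by simp)
  have hv : fderiv ℝ hypMap q (Pi.single i 1)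
      = (q i / hypMap q 0) • Pi.single 0 1 + if i = 0 then 0 else Pi.single i 1 := by
    ext j
    have : fderiv ℝ hypMap q (Pi.single i 1) j = pd i (fun p => hypMap p j) q := by
      rw [pd, fderiv_apply hd]
      rfl
    rw [this]
    refine Fin.cases ?_ (fun a => ?_) j
    · rw [pd_hypMap_zero hq]
      split_ifs with h
      · simp
      · simp [Ne.symm h]
    · simp_rw [hypMap_succ, pd_coord]
      split_ifs <;> simp_all
  have hc : fderiv ℝ (fun p => g (hypMap p)) q = (fderiv ℝ g (hypMap q)).comp (fderiv ℝ hypMap q) :=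
    fderiv_comp q hg hd
  rw [pd, hc, ContinuousLinearMap.comp_apply, hv]
  split_ifs <;> simp [pd]

theorem pd_zero_comp_hypMap {g : (Fin 4 → ℝ) → ℝ} {q : Fin 4 → ℝ} (hq : 0 < q 0)
    (hg : DifferentiableAt ℝ g (hypMap q)) :
    pd 0 (fun p => g (hypMap p)) q = q 0 / hypMap q 0 * pd 0 g (hypMap q) := by
  simp [pd_comp_hypMap hq hg]

theorem pd_succ_comp_hypMap {g : (Fin 4 → ℝ) → ℝ} {q : Fin 4 → ℝ} (hq : 0 < q 0)
    (hg : DifferentiableAt ℝ g (hypMap q)) (a : Fin 3) :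
    pd a.succ (fun p => g (hypMap p)) q = sdu a g (hypMap q) := by
  simp [pd_comp_hypMap hq hg, sdu, hypMap_succ]

/-- The wave operator in hyperboloidal coordinates `(s, x)`. -/
def hypBox (V : (Fin 4 → ℝ) → ℝ) (q : Fin 4 → ℝ) : ℝ :=
  pd 0 (pd 0 V) q + (q 0)⁻¹ * (3 * pd 0 V q)
    + (q 0)⁻¹ * (2 * (q 1 * pd 1 (pd 0 V) q + q 2 * pd 2 (pd 0 V) q + q 3 * pd 3 (pd 0 V) q))
    - (pd 1 (pd 1 V) q + pd 2 (pd 2 V) q + pd 3 (pd 3 V) q)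

theorem box_hypMap {u : (Fin 4 → ℝ) → ℝ} (hu : ContDiff ℝ ∞ u) {q : Fin 4 → ℝ} (hq : 0 < q 0) :
    box u (hypMap q) = hypBox (fun p => u (hypMap p)) q := by
  have ht : hypMap q 0 ≠ 0 := (hypMap_zero_pos hq).ne'
  have hdu : Differentiable ℝ u := hu.differentiable (by simp)
  have hdpu : ∀ i, Differentiable ℝ (pd i u) := fun i p =>
    (hu.contDiffAt.pd).differentiableAt (by simp)
  have hnh : ∀ᶠ p : Fin 4 → ℝ in 𝓝 q, 0 < p 0 :=
    (isOpen_lt continuous_const (continuous_apply 0)).mem_nhds hq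
  have hT : DifferentiableAt ℝ (fun p => hypMap p 0) q :=
    (contDiffAt_pi.1 (contDiffAt_hypMap hq) 0).differentiableAt (by simp)
  have hTi : DifferentiableAt ℝ (fun p => (hypMap p 0)⁻¹) q := hT.inv ht
  have hH : DifferentiableAt ℝ hypMap q := (contDiffAt_hypMap hq).differentiableAt (by simp)
  have hpc : ∀ i, DifferentiableAt ℝ (fun p => pd i u (hypMap p)) q := fun i =>
    (hdpu i _).comp q hH
  have hinv : ∀ i, pd i (fun p => (hypMap p 0)⁻¹) q = - (q i / hypMap q 0 ^ 3) := by
    intro i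
    have h := pd_mul (i := i) hT hTi
    have : (fun p => hypMap p 0 * (hypMap p 0)⁻¹) =ᶠ[𝓝 q] fun _ => 1 := by
      filter_upwards [hnh] with p hp using mul_inv_cancel₀ (hypMap_zero_pos hp).ne'
    rw [pd_congr this, pd_const, pd_hypMap_zero hq] at h
    field_simp at h ⊢
    linarith
  have e0 : pd 0 (fun p => u (hypMap p)) =ᶠ[𝓝 q]
      fun p => p 0 * (hypMap p 0)⁻¹ * pd 0 u (hypMap p) := by
    filter_upwards [hnh] with p hp
    rw [pd_zero_comp_hypMap hp (hdu _), div_eq_mul_inv]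
  have ea : ∀ i : Fin 4, i ≠ 0 → pd i (fun p => u (hypMap p)) =ᶠ[𝓝 q]
      fun p => p i * (hypMap p 0)⁻¹ * pd 0 u (hypMap p) + pd i u (hypMap p) := by
    intro i hi
    filter_upwards [hnh] with p hp
    rw [pd_comp_hypMap hp (hdu _), if_neg hi, div_eq_mul_inv]
  have e1 := ea 1 (by decide)
  have e2 := ea 2 (by decide)
  have e3 := ea 3 (by decide)
  have hsq := hypMap_zero_sq q
  simp only [Fin.sum_univ_three, Fin.succ_zero_eq_one, Fin.succ_one_eq_two, Fin.reduceSucc] at hsq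
  simp only [hypBox, box, Fin.sum_univ_three, Fin.succ_zero_eq_one, Fin.succ_one_eq_two,
    Fin.reduceSucc, pd_congr e0, pd_congr e1, pd_congr e2, pd_congr e3, e0.eq_of_nhds]
  simp (disch := fun_prop) only [pd_add, pd_mul, pd_coord, hinv, pd_comp_hypMap hq (hdpu _ _)]
  have c1 : pd 0 (pd 1 u) (hypMap q) = pd 1 (pd 0 u) (hypMap q) := pd_comm_s2 hu.contDiffAt
  have c2 : pd 0 (pd 2 u) (hypMap q) = pd 2 (pd 0 u) (hypMap q) := pd_comm_s2 hu.contDiffAt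
  have c3 : pd 0 (pd 3 u) (hypMap q) = pd 3 (pd 0 u) (hypMap q) := pd_comm_s2 hu.contDiffAt
  simp only [c1, c2, c3, Fin.reduceEq, if_true, if_false]
  set t := hypMap q 0
  have h0 : q 0 ≠ 0 := hq.ne'
  field_simp
  linear_combination (q 0 * t * pd 0 (pd 0 u) (hypMap q) - q 0 * pd 0 u (hypMap q)) * hsq

theorem coneSupported_comp_hypMap {u : (Fin 4 → ℝ) → ℝ} (hu : ContDiff ℝ ∞ u)
    (hv : vanishNearBdry u) : ConeSupported fun q => u (hypMap q) where
  contDiffAt q hq := hu.contDiffAt.comp q (contDiffAt_hypMap hq)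
  eq_zero q hq hq' := by
    obtain ⟨δ, hδ, h⟩ := hv
    refine h _ ?_
    have hr : ‖Fin.tail q‖ ≤ rad (hypMap q) := by
      refine (pi_norm_le_iff_of_nonneg (Real.sqrt_nonneg _)).2 fun a => ?_
      refine Real.le_sqrt_of_sq_le ?_
      simp_rw [hypMap_succ, Real.norm_eq_abs, sq_abs]
      exact Finset.single_le_sum (f := fun a : Fin 3 => q a.succ ^ 2)
        (fun _ _ => sq_nonneg _) (Finset.mem_univ a)
    have hs : hypMap q 0 ^ 2 = q 0 ^ 2 + rad (hypMap q) ^ 2 := by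
      rw [hypMap_zero_sq, rad, Real.sq_sqrt (by positivity)]
      simp_rw [hypMap_succ]
    nlinarith [hypMap_zero_pos hq, sq_nonneg (q 0), norm_nonneg (Fin.tail q)]

section Energy

variable (V : (Fin 4 → ℝ) → ℝ)

/-- The function `K u + 2 u` in hyperboloidal coordinates. -/
def conMult (q : Fin 4 → ℝ) : ℝ :=
  q 0 * pd 0 V q + 2 * (q 1 * pd 1 V q + q 2 * pd 2 V q + q 3 * pd 3 V q) + 2 * V q

/-- The square of the spatial gradient in hyperboloidal coordinates. -/
def gradSq (q : Fin 4 → ℝ) : ℝ :=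
  pd 1 V q * pd 1 V q + pd 2 V q * pd 2 V q + pd 3 V q * pd 3 V q

/-- The conformal energy density in hyperboloidal coordinates. -/
def conDensity (q : Fin 4 → ℝ) : ℝ :=
  conMult V q * conMult V q + q 0 * (q 0 * gradSq V q)

/-- The spatial flux of the conformal energy. -/
def conFlux (i : Fin 4) (q : Fin 4 → ℝ) : ℝ :=
  2 * (q 0 * (conMult V q * pd i V q - q i * gradSq V q))

variable {V}

theorem ConeSupported.conMult (hV : ConeSupported V) : ConeSupported (conMult V) :=
  ((hV.pd 0).coord_mul 0).add
    ((((((hV.pd 1).coord_mul 1).add ((hV.pd 2).coord_mul 2)).add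
      ((hV.pd 3).coord_mul 3))).const_mul 2) |>.add (hV.const_mul 2)

theorem ConeSupported.gradSq (hV : ConeSupported V) : ConeSupported (gradSq V) :=
  (((hV.pd 1).mul (hV.pd 1)).add ((hV.pd 2).mul (hV.pd 2))).add ((hV.pd 3).mul (hV.pd 3))

theorem ConeSupported.conDensity (hV : ConeSupported V) : ConeSupported (conDensity V) :=
  (hV.conMult.mul hV.conMult).add ((hV.gradSq.coord_mul 0).coord_mul 0)

theorem ConeSupported.conFlux (hV : ConeSupported V) (i : Fin 4) : ConeSupported (conFlux V i) :=
  (((hV.conMult.mul (hV.pd i)).sub (hV.gradSq.coord_mul i)).coord_mul 0).const_mul 2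

theorem ConeSupported.hypBox (hV : ConeSupported V) : ConeSupported (hypBox V) := by
  have hinv : ∀ q : Fin 4 → ℝ, 0 < q 0 → ContDiffAt ℝ ∞ (fun q : Fin 4 → ℝ => (q 0)⁻¹) q :=
    fun q hq => (contDiffAt_apply ℝ ℝ 0 q).inv hq.ne'
  have h0 := hV.pd 0
  exact (((h0.pd 0).add (smooth_mul hinv (h0.const_mul 3))).add
    (smooth_mul hinv (((((h0.pd 1).coord_mul 1).add ((h0.pd 2).coord_mul 2)).add
      ((h0.pd 3).coord_mul 3)).const_mul 2))).sub
    ((((hV.pd 1).pd 1).add ((hV.pd 2).pd 2)).add ((hV.pd 3).pd 3))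

theorem pd_zero_conDensity (hV : ConeSupported V) {q : Fin 4 → ℝ} (hq : 0 < q 0) :
    pd 0 (conDensity V) q = 2 * (q 0 * (conMult V q * hypBox V q))
      + (pd 1 (conFlux V 1) q + pd 2 (conFlux V 2) q + pd 3 (conFlux V 3) q) := by
  have dV := hV.differentiableAt hq
  have dP : ∀ i, DifferentiableAt ℝ (pd i V) q := fun i => (hV.pd i).differentiableAt hq
  have dM := hV.conMult.differentiableAt hq
  have dG := hV.gradSq.differentiableAt hq
  have hM : ∀ i, pd i (conMult V) q = _ := fun i => by
    unfold conMult
    simp (disch := fun_prop) only [pd_add, pd_mul, pd_coord, pd_const]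
    rfl
  have hG : ∀ i, pd i (gradSq V) q = _ := fun i => by
    unfold gradSq
    simp (disch := fun_prop) only [pd_add, pd_mul]
    rfl
  have hD : ∀ i, pd i (conDensity V) q = _ := fun i => by
    unfold conDensity
    simp (disch := fun_prop) only [pd_add, pd_mul, pd_coord]
    rfl
  have hF : ∀ i j, pd i (conFlux V j) q = _ := fun i j => by
    unfold conFlux
    simp (disch := fun_prop) only [pd_sub, pd_mul, pd_coord, pd_const]
    rfl
  have c : ∀ i j, pd i (pd j V) q = pd j (pd i V) q := fun i j => pd_comm_s2 (hV.contDiffAt q hq)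
  rw [hD, hF, hF, hF]
  simp only [hM, hG, Fin.reduceEq, if_true, if_false]
  rw [c 0 1, c 0 2, c 0 3, c 2 1, c 3 1, c 3 2]
  simp only [conMult, gradSq, hypBox]
  have h0 : q 0 ≠ 0 := hq.ne'
  field_simp
  ring

theorem hasDerivAt_conEnergy (hV : ConeSupported V) {s : ℝ} (hs : 0 < s) :
    HasDerivAt (fun τ => ∫ x : Fin 3 → ℝ, conDensity V (Fin.cons τ x))
      (2 * (s * ∫ x : Fin 3 → ℝ, conMult V (Fin.cons s x) * hypBox V (Fin.cons s x))) s := by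
  convert hV.conDensity.hasDerivAt_integral hs using 1
  have hpt : ∀ x : Fin 3 → ℝ, pd 0 (conDensity V) (Fin.cons s x)
      = 2 * (s * (conMult V (Fin.cons s x) * hypBox V (Fin.cons s x)))
      + (pd 1 (conFlux V 1) (Fin.cons s x) + pd 2 (conFlux V 2) (Fin.cons s x)
        + pd 3 (conFlux V 3) (Fin.cons s x)) := fun x =>
    pd_zero_conDensity hV (q := Fin.cons s x) (by simpa using hs)
  have hi : ∀ i, Integrable fun x : Fin 3 → ℝ => pd i (conFlux V i) (Fin.cons s x) :=
    fun i => ((hV.conFlux i).pd i).integrable_slice hs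
  have hMB := (hV.conMult.mul hV.hypBox).integrable_slice hs
  have z1 := (hV.conFlux 1).integral_pd_succ hs 0
  have z2 := (hV.conFlux 2).integral_pd_succ hs 1
  have z3 := (hV.conFlux 3).integral_pd_succ hs 2
  simp only [Fin.succ_zero_eq_one, Fin.succ_one_eq_two, Fin.reduceSucc] at z1 z2 z3
  simp_rw [hpt]
  rw [integral_add ((hMB.const_mul s).const_mul 2) (((hi 1).fun_add (hi 2)).fun_add (hi 3)),
    integral_add ((hi 1).fun_add (hi 2)) (hi 3), integral_add (hi 1) (hi 2), z1, z2, z3,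
    integral_const_mul, integral_const_mul]
  ring

end Energy

theorem integral_mul_le_sqrt_mul_sqrt {α : Type*} [MeasurableSpace α] {μ : Measure α} {f g : α → ℝ}
    (hf : Integrable (fun x => f x ^ 2) μ) (hg : Integrable (fun x => g x ^ 2) μ)
    (hfg : Integrable (fun x => f x * g x) μ) :
    ∫ x, f x * g x ∂μ ≤ √(∫ x, f x ^ 2 ∂μ) * √(∫ x, g x ^ 2 ∂μ) := by
  rw [← Real.sqrt_mul (integral_nonneg fun x => sq_nonneg _)]
  refine Real.le_sqrt_of_sq_le ?_
  have h : ∀ y : ℝ, 0 ≤ (∫ x, f x ^ 2 ∂μ) * (y * y) + (2 * ∫ x, f x * g x ∂μ) * y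
      + ∫ x, g x ^ 2 ∂μ := by
    intro y
    have : 0 ≤ ∫ x, (f x * y + g x) ^ 2 ∂μ := integral_nonneg fun x => sq_nonneg _
    have e : ∀ x, (f x * y + g x) ^ 2
        = (f x ^ 2 * (y * y) + (f x * g x) * (2 * y)) + g x ^ 2 := fun x => by ring
    simp_rw [e] at this
    rw [integral_add ((hf.mul_const _).fun_add (hfg.mul_const _)) hg,
      integral_add (hf.mul_const _) (hfg.mul_const _), integral_mul_const,
      integral_mul_const] at this
    linarith
  have := discrim_le_zero h
  rw [discrim] at this
  linarith

/-- A Grönwall-type bound for square roots: `E' ≤ 2 g √E` implies `√E(b) ≤ √E(a) + ∫ g`. -/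
theorem sqrt_le_sqrt_add_integral {E E' g : ℝ → ℝ} {a b : ℝ} (hab : a ≤ b)
    (hE : ∀ τ ∈ Set.Icc a b, HasDerivAt E (E' τ) τ) (hE0 : ∀ τ ∈ Set.Icc a b, 0 ≤ E τ)
    (hg : ContinuousOn g (Set.Icc a b)) (hg0 : ∀ τ ∈ Set.Icc a b, 0 ≤ g τ)
    (h : ∀ τ ∈ Set.Icc a b, E' τ ≤ 2 * (g τ * √(E τ))) :
    √(E b) ≤ √(E a) + ∫ τ in a..b, g τ := by
  refine le_of_forall_pos_le_add fun ε hε => ?_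
  have hpos : ∀ τ ∈ Set.Icc a b, 0 < E τ + ε ^ 2 := fun τ hτ => by
    have := hE0 τ hτ
    positivity
  have key : √(E b + ε ^ 2) - √(E a + ε ^ 2) ≤ ∫ τ in a..b, g τ := by
    refine intervalIntegral.sub_le_integral_of_hasDeriv_right_of_le hab
      (g := fun τ => √(E τ + ε ^ 2)) (g' := fun τ => E' τ / (2 * √(E τ + ε ^ 2))) ?_ ?_
      (hg.integrableOn_Icc) ?_
    · exact fun τ hτ => (((hE τ hτ).add_const _).sqrt
        (hpos τ hτ).ne').continuousAt.continuousWithinAt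
    · exact fun τ hτ => (((hE τ (Set.Ioo_subset_Icc_self hτ)).add_const _).sqrt
        (hpos τ (Set.Ioo_subset_Icc_self hτ)).ne').hasDerivWithinAt
    · intro τ hτ
      have hτ' := Set.Ioo_subset_Icc_self hτ
      have hp := Real.sqrt_pos.2 (hpos τ hτ')
      rw [div_le_iff₀ (by positivity)]
      have h1 : √(E τ) ≤ √(E τ + ε ^ 2) := Real.sqrt_le_sqrt (by linarith [sq_nonneg ε])
      nlinarith [h τ hτ', mul_le_mul_of_nonneg_left h1 (hg0 τ hτ')]
  have h1 : √(E b) ≤ √(E b + ε ^ 2) := Real.sqrt_le_sqrt (by linarith [sq_nonneg ε])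
  have h2 : √(E a + ε ^ 2) ≤ √(E a) + ε := by
    rw [Real.sqrt_le_left (by positivity)]
    nlinarith [Real.sq_sqrt (hE0 a ⟨le_rfl, hab⟩), Real.sqrt_nonneg (E a)]
  linarith

theorem Econ_eq_integral_conDensity {u : (Fin 4 → ℝ) → ℝ} (hu : ContDiff ℝ ∞ u) {s : ℝ}
    (hs : 0 < s) :
    Econ s u = ∫ x : Fin 3 → ℝ, conDensity (fun q => u (hypMap q)) (Fin.cons s x) := by
  have hdu : Differentiable ℝ u := hu.differentiable (by simp)
  refine integral_congr_ae (Filter.Eventually.of_forall fun x => ?_)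
  obtain ⟨q, hq⟩ : ∃ q : Fin 4 → ℝ, q = Fin.cons s x := ⟨_, rfl⟩
  have hq0 : q 0 = s := by simp [hq]
  have hpos : 0 < q 0 := hq0 ▸ hs
  have hsqrt : √(hypMap q 0 ^ 2 - rad (hypMap q) ^ 2) = q 0 := by
    rw [hypMap_zero_sq, rad, Real.sq_sqrt (by positivity)]
    simp_rw [hypMap_succ]
    rw [add_sub_cancel_right, Real.sqrt_sq hpos.le]
  have h0 := pd_zero_comp_hypMap hpos (hdu _)
  have h1 := pd_succ_comp_hypMap hpos (hdu _) 0
  have h2 := pd_succ_comp_hypMap hpos (hdu _) 1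
  have h3 := pd_succ_comp_hypMap hpos (hdu _) 2
  have k1 := hypMap_succ q 0
  have k2 := hypMap_succ q 1
  have k3 := hypMap_succ q 2
  simp only [Fin.succ_zero_eq_one, Fin.succ_one_eq_two, Fin.reduceSucc] at h1 h2 h3 k1 k2 k3
  simp only [← hypMap_cons, ← hq]
  rw [← hq0]
  simp only [Kop, hsqrt, conDensity, conMult, gradSq, h0, h1, h2, h3,
    Fin.sum_univ_three, Fin.succ_zero_eq_one, Fin.succ_one_eq_two, Fin.reduceSucc, k1, k2, k3]
  ring

theorem L2f_box_eq {u : (Fin 4 → ℝ) → ℝ} (hu : ContDiff ℝ ∞ u) {s : ℝ} (hs : 0 < s) :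
    L2f s (box u) = √(∫ x : Fin 3 → ℝ, hypBox (fun q => u (hypMap q)) (Fin.cons s x) ^ 2) := by
  rw [L2f]
  congr 1
  refine integral_congr_ae (Filter.Eventually.of_forall fun x => ?_)
  simp only [← hypMap_cons]
  rw [box_hypMap hu (by simpa using hs)]

/-- Hyperboloidal conformal energy estimate. -/
theorem stmt_2 : ∃ C > (0:ℝ), ∀ (s₀ s₁ : ℝ), 2 ≤ s₀ → s₀ ≤ s₁ →
    ∀ u : (Fin 4 → ℝ) → ℝ, ContDiff ℝ (⊤ : ℕ∞) u → vanishNearBdry u →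
      ∀ s ∈ Set.Icc s₀ s₁,
        Real.sqrt (Econ s u)
          ≤ Real.sqrt (Econ s₀ u) + C * ∫ τ in s₀..s, τ * L2f τ (box u) := by
  refine ⟨1, one_pos, fun s₀ s₁ h2 _ u hu hv s hs => ?_⟩
  have hV := coneSupported_comp_hypMap hu hv
  set V : (Fin 4 → ℝ) → ℝ := fun q => u (hypMap q)
  have hpos : ∀ τ ∈ Set.Icc s₀ s, 0 < τ := fun τ hτ => by linarith [hτ.1]
  have hEq : ∀ τ ∈ Set.Icc s₀ s, Econ τ u = ∫ x : Fin 3 → ℝ, conDensity V (Fin.cons τ x) :=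
    fun τ hτ => Econ_eq_integral_conDensity hu (hpos τ hτ)
  have hnn : ∀ q, 0 ≤ gradSq V q := fun q => by
    unfold gradSq
    nlinarith [sq_nonneg (pd 1 V q), sq_nonneg (pd 2 V q), sq_nonneg (pd 3 V q)]
  have hle : ∀ q, conMult V q ^ 2 ≤ conDensity V q := fun q => by
    unfold conDensity
    nlinarith [mul_nonneg (sq_nonneg (q 0)) (hnn q)]
  rw [one_mul, hEq s ⟨hs.1, le_rfl⟩, hEq s₀ ⟨le_rfl, hs.1⟩]
  refine sqrt_le_sqrt_add_integral hs.1
    (E := fun τ => ∫ x : Fin 3 → ℝ, conDensity V (Fin.cons τ x))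
    (fun τ hτ => hasDerivAt_conEnergy hV (hpos τ hτ))
    (fun τ _ => integral_nonneg fun x => (sq_nonneg _).trans (hle _)) ?_
    (fun τ hτ => mul_nonneg (hpos τ hτ).le (Real.sqrt_nonneg _)) fun τ hτ => ?_
  · refine ContinuousOn.congr (f := fun τ =>
      τ * √(∫ x : Fin 3 → ℝ, hypBox V (Fin.cons τ x) * hypBox V (Fin.cons τ x))) ?_ ?_
    · exact fun τ hτ => (continuousAt_id.mul
        ((hV.hypBox.mul hV.hypBox).hasDerivAt_integral
          (hpos τ hτ)).continuousAt.sqrt).continuousWithinAt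
    · intro τ hτ
      simp only [L2f_box_eq hu (hpos τ hτ), sq, V]
  · have hτ0 := hpos τ hτ
    have hM2 : Integrable fun x : Fin 3 → ℝ => conMult V (Fin.cons τ x) ^ 2 := by
      simpa only [sq] using (hV.conMult.mul hV.conMult).integrable_slice hτ0
    have hB2 : Integrable fun x : Fin 3 → ℝ => hypBox V (Fin.cons τ x) ^ 2 := by
      simpa only [sq] using (hV.hypBox.mul hV.hypBox).integrable_slice hτ0
    have hcs := integral_mul_le_sqrt_mul_sqrt hM2 hB2
      ((hV.conMult.mul hV.hypBox).integrable_slice hτ0)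
    have hmono : √(∫ x : Fin 3 → ℝ, conMult V (Fin.cons τ x) ^ 2)
        ≤ √(∫ x : Fin 3 → ℝ, conDensity V (Fin.cons τ x)) :=
      Real.sqrt_le_sqrt (integral_mono hM2 (hV.conDensity.integrable_slice hτ0) fun x => hle _)
    rw [L2f_box_eq hu hτ0, mul_assoc]
    have := hcs.trans (mul_le_mul_of_nonneg_right hmono (Real.sqrt_nonneg _))
    rw [mul_comm √(∫ x : Fin 3 → ℝ, conDensity V (Fin.cons τ x))] at this
    exact mul_le_mul_of_nonneg_left (mul_le_mul_of_nonneg_left this hτ0.le) zero_le_two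
end
end

section
/- Pointwise estimate for the wave equation with decaying source: There is a universal constant C > 0 with the following property. Let 0 < μ ≤ 1/2 and ν ∈ ℝ with 0 < |ν| ≤ 1/2. Let f be a continuous function on [2,∞)×ℝ³ vanishing outside K = {r < t − 1} and satisfying |f(t,x)| ≤ C_f · t^{−2−ν} (t − r)^{−1+μ} for some constant C_f > 0. Let u be the solution to □u = f on [2,∞)×ℝ³ with u(2,·) = 0 and ∂_t u(2,·) = 0. Then for all (t,x) with t ≥ 2 and r < t: if 0 < ν ≤ 1/2 then |u(t,x)| ≤ C·C_f·(νμ)^{−1} (t−r)^{μ−ν} t^{−1}, while if −1/2 ≤ ν < 0 then |u(t,x)| ≤ C·C_f·(|ν|μ)^{−1} (t−r)^{μ} t^{−1−ν}. -/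
noncomputable section
open MeasureTheory

theorem integral_integral_swap_of_continuous {g : ℝ → ℝ → ℝ}
    (hg : Continuous (Function.uncurry g)) (a b c d : ℝ) :
    ∫ x in a..b, ∫ y in c..d, g x y = ∫ y in c..d, ∫ x in a..b, g x y := by
  refine intervalIntegral_intervalIntegral_swap ?_
  exact (hg.continuousOn.integrableOn_compact
    (isCompact_uIcc.prod isCompact_uIcc)).mono_set
      (Set.prod_mono Set.uIoc_subset_uIcc Set.uIoc_subset_uIcc)

section Kirchhoff

variable {E : Type*} [NormedAddCommGroup E] [NormedSpace ℝ E]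

/-- The radial unit vector of spherical coordinates, in the frame `e`. -/
def sphR (e : Fin 3 → E) (θ φ : ℝ) : E :=
  (Real.sin θ * Real.cos φ) • e 0 + (Real.sin θ * Real.sin φ) • e 1 + Real.cos θ • e 2

/-- The polar unit vector of spherical coordinates, in the frame `e`. -/
def sphTheta (e : Fin 3 → E) (θ φ : ℝ) : E :=
  (Real.cos θ * Real.cos φ) • e 0 + (Real.cos θ * Real.sin φ) • e 1 - Real.sin θ • e 2

/-- The azimuthal unit vector of spherical coordinates, in the frame `e`. -/
def sphPhi (e : Fin 3 → E) (φ : ℝ) : E :=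
  (-Real.sin φ) • e 0 + Real.cos φ • e 1

/-- Spherical coordinates on the backward light cone with vertex `x₀` and time direction `e₀`. -/
def conePt (x₀ e₀ : E) (e : Fin 3 → E) (ρ θ φ : ℝ) : E :=
  x₀ + ρ • (sphR e θ φ - e₀)

theorem hasDerivAt_sphR_theta (e : Fin 3 → E) (θ φ : ℝ) :
    HasDerivAt (fun θ => sphR e θ φ) (sphTheta e θ φ) θ := by
  have := ((((Real.hasDerivAt_sin θ).mul_const (Real.cos φ)).smul_const (e 0)).add
    (((Real.hasDerivAt_sin θ).mul_const (Real.sin φ)).smul_const (e 1))).add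
    ((Real.hasDerivAt_cos θ).smul_const (e 2))
  exact this.congr_deriv (by simp only [sphTheta]; module)

theorem hasDerivAt_sphTheta_theta (e : Fin 3 → E) (θ φ : ℝ) :
    HasDerivAt (fun θ => sphTheta e θ φ) (-sphR e θ φ) θ := by
  have := ((((Real.hasDerivAt_cos θ).mul_const (Real.cos φ)).smul_const (e 0)).add
    (((Real.hasDerivAt_cos θ).mul_const (Real.sin φ)).smul_const (e 1))).sub
    ((Real.hasDerivAt_sin θ).smul_const (e 2))
  exact this.congr_deriv (by simp only [sphR]; module)

theorem hasDerivAt_sphR_phi (e : Fin 3 → E) (θ φ : ℝ) :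
    HasDerivAt (fun φ => sphR e θ φ) (Real.sin θ • sphPhi e φ) φ := by
  have := ((((Real.hasDerivAt_cos φ).const_mul (Real.sin θ)).smul_const (e 0)).add
    (((Real.hasDerivAt_sin φ).const_mul (Real.sin θ)).smul_const (e 1))).add_const
    (Real.cos θ • e 2)
  exact this.congr_deriv (by simp only [sphPhi]; module)

theorem hasDerivAt_sphPhi (e : Fin 3 → E) (φ : ℝ) :
    HasDerivAt (sphPhi e) (-(Real.cos φ • e 0 + Real.sin φ • e 1)) φ := by
  have := (((Real.hasDerivAt_sin φ).neg).smul_const (e 0)).add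
    ((Real.hasDerivAt_cos φ).smul_const (e 1))
  exact this.congr_deriv (by module)

theorem continuous_sphR (e : Fin 3 → E) : Continuous fun q : ℝ × ℝ => sphR e q.1 q.2 := by
  unfold sphR; fun_prop

theorem continuous_sphTheta (e : Fin 3 → E) :
    Continuous fun q : ℝ × ℝ => sphTheta e q.1 q.2 := by
  unfold sphTheta; fun_prop

theorem continuous_sphPhi (e : Fin 3 → E) : Continuous (sphPhi e) := by
  unfold sphPhi; fun_prop

theorem continuous_conePt (x₀ e₀ : E) (e : Fin 3 → E) :
    Continuous fun q : ℝ × ℝ × ℝ => conePt x₀ e₀ e q.1 q.2.1 q.2.2 := by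
  unfold conePt sphR; fun_prop

theorem sum_apply_sph_frame (B : E →L[ℝ] E →L[ℝ] ℝ) (e : Fin 3 → E) (θ φ : ℝ) :
    B (sphR e θ φ) (sphR e θ φ) + B (sphTheta e θ φ) (sphTheta e θ φ)
      + B (sphPhi e φ) (sphPhi e φ) = ∑ i, B (e i) (e i) := by
  have h1 := Real.sin_sq_add_cos_sq θ
  have h2 := Real.sin_sq_add_cos_sq φ
  simp only [sphR, sphTheta, sphPhi, map_add, map_sub, map_smul, add_apply,
    sub_apply, smul_apply, smul_eq_mul, Fin.sum_univ_three]
  generalize Real.sin θ = s at *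
  generalize Real.cos θ = c at *
  generalize Real.sin φ = s' at *
  generalize Real.cos φ = c' at *
  have h3 : c ^ 2 = 1 - s ^ 2 := by linarith
  have h4 : c' ^ 2 = 1 - s' ^ 2 := by linarith
  ring_nf
  simp only [h3, h4]
  ring

variable {u : E → ℝ}

theorem contDiff_fderiv_of_two (hu : ContDiff ℝ 2 u) : ContDiff ℝ 1 (fderiv ℝ u) :=
  hu.fderiv_right (by norm_num)

theorem HasDerivAt.fderiv_comp_apply (hu : ContDiff ℝ 2 u) {c v : ℝ → E} {c' v' : E} {s : ℝ}
    (hc : HasDerivAt c c' s) (hv : HasDerivAt v v' s) :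
    HasDerivAt (fun s => fderiv ℝ u (c s) (v s))
      (fderiv ℝ (fderiv ℝ u) (c s) c' (v s) + fderiv ℝ u (c s) v') s := by
  have h1 : HasFDerivAt (fderiv ℝ u) (fderiv ℝ (fderiv ℝ u) (c s)) (c s) :=
    ((contDiff_fderiv_of_two hu).differentiable (by norm_num) _).hasFDerivAt
  exact (h1.comp_hasDerivAt s hc).clm_apply hv

/-- The flux `u + ρ ∂_r u + ρ ∂_t u` through the sphere of radius `ρ` of the backward cone. -/
def coneFlux (u : E → ℝ) (x₀ e₀ : E) (e : Fin 3 → E) (ρ θ φ : ℝ) : ℝ :=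
  u (conePt x₀ e₀ e ρ θ φ) + ρ * fderiv ℝ u (conePt x₀ e₀ e ρ θ φ) (sphR e θ φ + e₀)

/-- The wave operator in the frame `e₀, e`. -/
def frameBox (u : E → ℝ) (e₀ : E) (e : Fin 3 → E) (p : E) : ℝ :=
  fderiv ℝ (fderiv ℝ u) p e₀ e₀ - ∑ i, fderiv ℝ (fderiv ℝ u) p (e i) (e i)

theorem hasDerivAt_coneFlux (hu : ContDiff ℝ 2 u) (x₀ e₀ : E) (e : Fin 3 → E) (ρ θ φ : ℝ) :
    HasDerivAt (fun ρ => coneFlux u x₀ e₀ e ρ θ φ)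
      (2 * fderiv ℝ u (conePt x₀ e₀ e ρ θ φ) (sphR e θ φ) +
        ρ * (fderiv ℝ (fderiv ℝ u) (conePt x₀ e₀ e ρ θ φ) (sphR e θ φ) (sphR e θ φ)
          - fderiv ℝ (fderiv ℝ u) (conePt x₀ e₀ e ρ θ φ) e₀ e₀)) ρ := by
  have hc : HasDerivAt (fun ρ => conePt x₀ e₀ e ρ θ φ) (sphR e θ φ - e₀) ρ := by
    have := ((hasDerivAt_id ρ).smul_const (sphR e θ φ - e₀)).const_add x₀
    exact this.congr_deriv (by simp)
  have h1 := ((hu.differentiable (by norm_num) _).hasFDerivAt).comp_hasDerivAt ρ hc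
  have h2 := (hasDerivAt_id ρ).mul
    (hc.fderiv_comp_apply hu (hasDerivAt_const ρ (sphR e θ φ + e₀)))
  refine (h1.add h2).congr_deriv ?_
  have hs := (hu.contDiffAt (x := conePt x₀ e₀ e ρ θ φ)).isSymmSndFDerivAt (by simp)
    (sphR e θ φ) e₀
  simp only [id, map_add, map_sub, map_zero, sub_apply, hs]
  ring

theorem hasDerivAt_polar_flux (hu : ContDiff ℝ 2 u) (x₀ e₀ : E) (e : Fin 3 → E) (ρ θ φ : ℝ) :
    HasDerivAt (fun θ => Real.sin θ * fderiv ℝ u (conePt x₀ e₀ e ρ θ φ) (sphTheta e θ φ))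
      (Real.cos θ * fderiv ℝ u (conePt x₀ e₀ e ρ θ φ) (sphTheta e θ φ) + Real.sin θ *
        (ρ * fderiv ℝ (fderiv ℝ u) (conePt x₀ e₀ e ρ θ φ) (sphTheta e θ φ) (sphTheta e θ φ)
          - fderiv ℝ u (conePt x₀ e₀ e ρ θ φ) (sphR e θ φ))) θ := by
  have hc : HasDerivAt (fun θ => conePt x₀ e₀ e ρ θ φ) (ρ • sphTheta e θ φ) θ :=
    (((hasDerivAt_sphR_theta e θ φ).sub_const e₀).const_smul ρ).const_add x₀
  refine ((Real.hasDerivAt_sin θ).mul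
    (hc.fderiv_comp_apply hu (hasDerivAt_sphTheta_theta e θ φ))).congr_deriv ?_
  simp only [map_smul, map_neg, smul_apply, smul_eq_mul]
  ring

theorem hasDerivAt_azimuthal_flux (hu : ContDiff ℝ 2 u) (x₀ e₀ : E) (e : Fin 3 → E)
    (ρ θ φ : ℝ) :
    HasDerivAt (fun φ => fderiv ℝ u (conePt x₀ e₀ e ρ θ φ) (sphPhi e φ))
      (ρ * Real.sin θ * fderiv ℝ (fderiv ℝ u) (conePt x₀ e₀ e ρ θ φ) (sphPhi e φ) (sphPhi e φ)
        - fderiv ℝ u (conePt x₀ e₀ e ρ θ φ) (Real.cos φ • e 0 + Real.sin φ • e 1)) φ := by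
  have hc : HasDerivAt (fun φ => conePt x₀ e₀ e ρ θ φ) (ρ • Real.sin θ • sphPhi e φ) φ :=
    (((hasDerivAt_sphR_phi e θ φ).sub_const e₀).const_smul ρ).const_add x₀
  refine (hc.fderiv_comp_apply hu (hasDerivAt_sphPhi e φ)).congr_deriv ?_
  simp only [map_smul, map_neg, smul_apply, smul_eq_mul]
  ring

/-- The wave operator on a backward light cone is a divergence in spherical coordinates. -/
theorem cone_divergence_identity (x₀ e₀ : E) (e : Fin 3 → E) (ρ θ φ : ℝ) :
    Real.sin θ * (2 * fderiv ℝ u (conePt x₀ e₀ e ρ θ φ) (sphR e θ φ) +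
        ρ * (fderiv ℝ (fderiv ℝ u) (conePt x₀ e₀ e ρ θ φ) (sphR e θ φ) (sphR e θ φ)
          - fderiv ℝ (fderiv ℝ u) (conePt x₀ e₀ e ρ θ φ) e₀ e₀))
      + (Real.cos θ * fderiv ℝ u (conePt x₀ e₀ e ρ θ φ) (sphTheta e θ φ) + Real.sin θ *
        (ρ * fderiv ℝ (fderiv ℝ u) (conePt x₀ e₀ e ρ θ φ) (sphTheta e θ φ) (sphTheta e θ φ)
          - fderiv ℝ u (conePt x₀ e₀ e ρ θ φ) (sphR e θ φ)))
      + (ρ * Real.sin θ * fderiv ℝ (fderiv ℝ u) (conePt x₀ e₀ e ρ θ φ) (sphPhi e φ) (sphPhi e φ)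
        - fderiv ℝ u (conePt x₀ e₀ e ρ θ φ) (Real.cos φ • e 0 + Real.sin φ • e 1))
      = -(ρ * Real.sin θ * frameBox u e₀ e (conePt x₀ e₀ e ρ θ φ)) := by
  have key : Real.cos θ • sphTheta e θ φ + Real.sin θ • sphR e θ φ
      = Real.cos φ • e 0 + Real.sin φ • e 1 := by
    have h1 := Real.sin_sq_add_cos_sq θ
    have h2 : Real.cos φ • e 0 + Real.sin φ • e 1
      = ((Real.sin θ ^ 2 + Real.cos θ ^ 2) * Real.cos φ) • e 0
        + ((Real.sin θ ^ 2 + Real.cos θ ^ 2) * Real.sin φ) • e 1 := by rw [h1]; simp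
    rw [h2]
    simp only [sphTheta, sphR]
    module
  rw [frameBox, ← sum_apply_sph_frame _ e θ φ, ← key]
  simp only [map_add, map_smul, smul_eq_mul]
  ring

/-- Kirchhoff's formula, with zero data on the base of the backward cone. -/
theorem kirchhoff (hu : ContDiff ℝ 2 u) (x₀ e₀ : E) (e : Fin 3 → E) (T : ℝ)
    (h0 : ∀ θ φ, u (conePt x₀ e₀ e T θ φ) = 0)
    (h1 : ∀ θ φ, fderiv ℝ u (conePt x₀ e₀ e T θ φ) = 0) :
    ∫ φ in (0:ℝ)..(2 * Real.pi), ∫ θ in (0:ℝ)..Real.pi, ∫ ρ in (0:ℝ)..T,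
      ρ * Real.sin θ * frameBox u e₀ e (conePt x₀ e₀ e ρ θ φ) = 4 * Real.pi * u x₀ := by
  have cD1 : Continuous (fderiv ℝ u) := (contDiff_fderiv_of_two hu).continuous
  have cD2 : Continuous (fderiv ℝ (fderiv ℝ u)) :=
    (contDiff_fderiv_of_two hu).continuous_fderiv (by norm_num)
  have cP := continuous_conePt x₀ e₀ e
  have cR : Continuous fun q : ℝ × ℝ × ℝ => sphR e q.2.1 q.2.2 :=
    (continuous_sphR e).comp continuous_snd
  have cT : Continuous fun q : ℝ × ℝ × ℝ => sphTheta e q.2.1 q.2.2 :=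
    (continuous_sphTheta e).comp continuous_snd
  have cF : Continuous fun q : ℝ × ℝ × ℝ => sphPhi e q.2.2 :=
    (continuous_sphPhi e).comp (continuous_snd.comp continuous_snd)
  have cd1 := cD1.comp cP
  have cd2 := cD2.comp cP
  have cH : Continuous fun q : ℝ × ℝ × ℝ => Real.cos q.2.2 • e 0 + Real.sin q.2.2 • e 1 := by
    fun_prop
  set P1 : ℝ → ℝ → ℝ → ℝ := fun ρ θ φ =>
    2 * fderiv ℝ u (conePt x₀ e₀ e ρ θ φ) (sphR e θ φ) +
        ρ * (fderiv ℝ (fderiv ℝ u) (conePt x₀ e₀ e ρ θ φ) (sphR e θ φ) (sphR e θ φ)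
          - fderiv ℝ (fderiv ℝ u) (conePt x₀ e₀ e ρ θ φ) e₀ e₀) with hP1
  set P2 : ℝ → ℝ → ℝ → ℝ := fun ρ θ φ =>
    Real.cos θ * fderiv ℝ u (conePt x₀ e₀ e ρ θ φ) (sphTheta e θ φ) + Real.sin θ *
        (ρ * fderiv ℝ (fderiv ℝ u) (conePt x₀ e₀ e ρ θ φ) (sphTheta e θ φ) (sphTheta e θ φ)
          - fderiv ℝ u (conePt x₀ e₀ e ρ θ φ) (sphR e θ φ)) with hP2
  set P3 : ℝ → ℝ → ℝ → ℝ := fun ρ θ φ =>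
    ρ * Real.sin θ * fderiv ℝ (fderiv ℝ u) (conePt x₀ e₀ e ρ θ φ) (sphPhi e φ) (sphPhi e φ)
        - fderiv ℝ u (conePt x₀ e₀ e ρ θ φ) (Real.cos φ • e 0 + Real.sin φ • e 1) with hP3
  have c1 : Continuous fun q : ℝ × ℝ × ℝ => P1 q.1 q.2.1 q.2.2 :=
    (continuous_const.mul (cd1.clm_apply cR)).add (continuous_fst.mul
      (((cd2.clm_apply cR).clm_apply cR).sub
        ((cd2.clm_apply continuous_const).clm_apply continuous_const)))
  have cs : Continuous fun q : ℝ × ℝ × ℝ => Real.sin q.2.1 := by fun_prop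
  have cc : Continuous fun q : ℝ × ℝ × ℝ => Real.cos q.2.1 := by fun_prop
  have c2 : Continuous fun q : ℝ × ℝ × ℝ => P2 q.1 q.2.1 q.2.2 :=
    (cc.mul (cd1.clm_apply cT)).add (cs.mul
      ((continuous_fst.mul ((cd2.clm_apply cT).clm_apply cT)).sub (cd1.clm_apply cR)))
  have c3 : Continuous fun q : ℝ × ℝ × ℝ => P3 q.1 q.2.1 q.2.2 :=
    ((continuous_fst.mul cs).mul ((cd2.clm_apply cF).clm_apply cF)).sub (cd1.clm_apply cH)
  -- continuity of the pieces as functions of fewer variables, in any order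
  have slice : ∀ {P : ℝ → ℝ → ℝ → ℝ}, Continuous (fun q : ℝ × ℝ × ℝ => P q.1 q.2.1 q.2.2) →
      ∀ {X : Type} [TopologicalSpace X] {a b c : X → ℝ}, Continuous a → Continuous b →
        Continuous c → Continuous fun x => P (a x) (b x) (c x) := by
    intro P hP X _ a b c ha hb hc
    exact hP.comp (ha.prodMk (hb.prodMk hc))
  have I1 : ∀ θ φ, ∫ ρ in (0:ℝ)..T, P1 ρ θ φ = - u x₀ := by
    intro θ φ
    rw [intervalIntegral.integral_eq_sub_of_hasDerivAt
      (fun ρ _ => hasDerivAt_coneFlux hu x₀ e₀ e ρ θ φ)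
      ((slice c1 continuous_id continuous_const continuous_const).intervalIntegrable _ _)]
    have : conePt x₀ e₀ e 0 θ φ = x₀ := by simp [conePt]
    simp [coneFlux, h0, h1, this]
  have I2 : ∀ ρ φ, ∫ θ in (0:ℝ)..Real.pi, P2 ρ θ φ = 0 := by
    intro ρ φ
    rw [intervalIntegral.integral_eq_sub_of_hasDerivAt
      (fun θ _ => hasDerivAt_polar_flux hu x₀ e₀ e ρ θ φ)
      ((slice c2 continuous_const continuous_id continuous_const).intervalIntegrable _ _)]
    simp
  have I3 : ∀ ρ θ, ∫ φ in (0:ℝ)..(2 * Real.pi), P3 ρ θ φ = 0 := by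
    intro ρ θ
    rw [intervalIntegral.integral_eq_sub_of_hasDerivAt
      (fun φ _ => hasDerivAt_azimuthal_flux hu x₀ e₀ e ρ θ φ)
      ((slice c3 continuous_const continuous_const continuous_id).intervalIntegrable _ _)]
    simp [conePt, sphR, sphPhi]
  have J : ∀ φ, ∫ θ in (0:ℝ)..Real.pi, ∫ ρ in (0:ℝ)..T,
      ρ * Real.sin θ * frameBox u e₀ e (conePt x₀ e₀ e ρ θ φ)
      = 2 * u x₀ - ∫ θ in (0:ℝ)..Real.pi, ∫ ρ in (0:ℝ)..T, P3 ρ θ φ := by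
    intro φ
    have hpt : ∀ ρ θ, ρ * Real.sin θ * frameBox u e₀ e (conePt x₀ e₀ e ρ θ φ)
        = -(Real.sin θ * P1 ρ θ φ) - P2 ρ θ φ - P3 ρ θ φ := by
      intro ρ θ
      have := cone_divergence_identity (u := u) x₀ e₀ e ρ θ φ
      simp only [hP1, hP2, hP3]
      linarith
    have hin : ∀ θ, ∫ ρ in (0:ℝ)..T,
        ρ * Real.sin θ * frameBox u e₀ e (conePt x₀ e₀ e ρ θ φ)
        = Real.sin θ * u x₀ - (∫ ρ in (0:ℝ)..T, P2 ρ θ φ) - ∫ ρ in (0:ℝ)..T, P3 ρ θ φ := by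
      intro θ
      have i1 := (slice c1 continuous_id (continuous_const (y := θ))
        (continuous_const (y := φ))).intervalIntegrable (μ := volume) 0 T
      have i2 := (slice c2 continuous_id (continuous_const (y := θ))
        (continuous_const (y := φ))).intervalIntegrable (μ := volume) 0 T
      have i3 := (slice c3 continuous_id (continuous_const (y := θ))
        (continuous_const (y := φ))).intervalIntegrable (μ := volume) 0 T
      simp only [id] at i1 i2 i3
      have i1' : IntervalIntegrable (fun ρ => -(Real.sin θ * P1 ρ θ φ)) volume 0 T :=
        (i1.const_mul _).neg
      have i12 : IntervalIntegrable (fun ρ => -(Real.sin θ * P1 ρ θ φ) - P2 ρ θ φ) volume 0 T :=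
        i1'.sub i2
      simp only [hpt]
      rw [intervalIntegral.integral_sub i12 i3, intervalIntegral.integral_sub i1' i2,
        intervalIntegral.integral_neg, intervalIntegral.integral_const_mul, I1]
      ring
    simp only [hin]
    have k2 : Continuous fun θ => ∫ ρ in (0:ℝ)..T, P2 ρ θ φ :=
      intervalIntegral.continuous_parametric_intervalIntegral_of_continuous'
        (f := fun θ ρ => P2 ρ θ φ) (slice c2 continuous_snd continuous_fst continuous_const) 0 T
    have k3 : Continuous fun θ => ∫ ρ in (0:ℝ)..T, P3 ρ θ φ :=
      intervalIntegral.continuous_parametric_intervalIntegral_of_continuous'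
        (f := fun θ ρ => P3 ρ θ φ) (slice c3 continuous_snd continuous_fst continuous_const) 0 T
    have k1 : Continuous fun θ => Real.sin θ * u x₀ := by fun_prop
    have k12 : Continuous fun θ => Real.sin θ * u x₀ - ∫ ρ in (0:ℝ)..T, P2 ρ θ φ := k1.sub k2
    rw [intervalIntegral.integral_sub (k12.intervalIntegrable _ _)
        (k3.intervalIntegrable _ _),
      intervalIntegral.integral_sub (k1.intervalIntegrable _ _) (k2.intervalIntegrable _ _),
      intervalIntegral.integral_mul_const, integral_sin,
      integral_integral_swap_of_continuous (g := fun θ ρ => P2 ρ θ φ)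
        (slice c2 continuous_snd continuous_fst continuous_const)]
    simp only [I2, intervalIntegral.integral_zero, Real.cos_zero, Real.cos_pi]
    ring
  simp only [J]
  have m3 : Continuous fun q : ℝ × ℝ => ∫ ρ in (0:ℝ)..T, P3 ρ q.2 q.1 :=
    intervalIntegral.continuous_parametric_intervalIntegral_of_continuous'
      (f := fun (q : ℝ × ℝ) ρ => P3 ρ q.2 q.1) (slice c3 continuous_snd
        (continuous_snd.comp continuous_fst) (continuous_fst.comp continuous_fst)) 0 T
  have m3' : Continuous fun φ => ∫ θ in (0:ℝ)..Real.pi, ∫ ρ in (0:ℝ)..T, P3 ρ θ φ :=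
    intervalIntegral.continuous_parametric_intervalIntegral_of_continuous'
      (f := fun φ θ => ∫ ρ in (0:ℝ)..T, P3 ρ θ φ) m3 0 Real.pi
  have z : ∫ φ in (0:ℝ)..(2 * Real.pi), ∫ θ in (0:ℝ)..Real.pi, ∫ ρ in (0:ℝ)..T, P3 ρ θ φ
      = 0 := by
    rw [integral_integral_swap_of_continuous
      (g := fun φ θ => ∫ ρ in (0:ℝ)..T, P3 ρ θ φ) m3]
    have : ∀ θ, ∫ φ in (0:ℝ)..(2 * Real.pi), ∫ ρ in (0:ℝ)..T, P3 ρ θ φ = 0 := by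
      intro θ
      rw [integral_integral_swap_of_continuous (g := fun φ ρ => P3 ρ θ φ)
        (slice c3 continuous_snd continuous_const continuous_fst)]
      simp [I3]
    simp [this]
  rw [intervalIntegral.integral_sub (by simp) (m3'.intervalIntegrable _ _), z]
  simp
  ring

end Kirchhoff

section Estimates

/-- A primitive of `arsinhWeight μ`. -/
def arsinhPrim (μ y : ℝ) : ℝ := Real.exp (μ * Real.arsinh y) / μ

/-- A smooth positive majorant, up to a constant, of `y ^ (-1 + μ)` on `y ≥ 1`. -/
def arsinhWeight (μ y : ℝ) : ℝ := Real.exp (μ * Real.arsinh y) * (√(1 + y ^ 2))⁻¹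

theorem arsinhWeight_pos (μ y : ℝ) : 0 < arsinhWeight μ y := by
  unfold arsinhWeight; positivity

theorem arsinhPrim_pos {μ : ℝ} (hμ : 0 < μ) (y : ℝ) : 0 < arsinhPrim μ y := by
  unfold arsinhPrim; positivity

theorem arsinhPrim_mono {μ : ℝ} (hμ : 0 < μ) {x y : ℝ} (h : x ≤ y) :
    arsinhPrim μ x ≤ arsinhPrim μ y := by
  unfold arsinhPrim
  have := Real.arsinh_le_arsinh.2 h
  gcongr

theorem hasDerivAt_arsinhPrim {μ : ℝ} (hμ : 0 < μ) (y : ℝ) :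
    HasDerivAt (arsinhPrim μ) (arsinhWeight μ y) y := by
  refine ((((Real.hasDerivAt_arsinh y).const_mul μ).exp).div_const μ).congr_deriv ?_
  unfold arsinhWeight
  field_simp

theorem exp_mul_arsinh (μ y : ℝ) :
    Real.exp (μ * Real.arsinh y) = (y + √(1 + y ^ 2)) ^ μ := by
  rw [← Real.exp_arsinh, ← Real.exp_mul, mul_comm]

theorem rpow_le_two_mul_arsinhWeight {μ y : ℝ} (hμ : 0 < μ) (hy : 1 ≤ y) :
    y ^ (-1 + μ) ≤ 2 * arsinhWeight μ y := by
  have h0 : 0 < y := by linarith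
  have h1 : √(1 + y ^ 2) ≤ 2 * y := by
    rw [Real.sqrt_le_left (by linarith)]; nlinarith
  have h2 : 0 < √(1 + y ^ 2) := by positivity
  have h3 : y ^ μ ≤ (y + √(1 + y ^ 2)) ^ μ := by
    apply Real.rpow_le_rpow <;> linarith
  rw [arsinhWeight, exp_mul_arsinh, Real.rpow_add h0, Real.rpow_neg_one]
  calc y⁻¹ * y ^ μ = 2 * (y ^ μ * (2 * y)⁻¹) := by field_simp
    _ ≤ 2 * ((y + √(1 + y ^ 2)) ^ μ * (√(1 + y ^ 2))⁻¹) := by gcongr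

theorem arsinhPrim_le {μ y : ℝ} (hμ : 0 < μ) (hμ' : μ ≤ 1 / 2) (hy : 1 ≤ y) :
    arsinhPrim μ y ≤ 2 * y ^ μ / μ := by
  have h0 : 0 < y := by linarith
  have h1 : √(1 + y ^ 2) ≤ 2 * y := by
    rw [Real.sqrt_le_left (by linarith)]; nlinarith
  have h2 : 0 < √(1 + y ^ 2) := by positivity
  have h4 : (4:ℝ) ^ μ ≤ 2 := by
    calc (4:ℝ) ^ μ ≤ 4 ^ (1 / 2 : ℝ) := Real.rpow_le_rpow_of_exponent_le (by norm_num) hμ'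
      _ = 2 := by rw [← Real.sqrt_eq_rpow, show (4:ℝ) = 2 ^ 2 by norm_num]; simp
  rw [arsinhPrim, exp_mul_arsinh]
  gcongr
  calc (y + √(1 + y ^ 2)) ^ μ ≤ (4 * y) ^ μ := by gcongr; linarith
    _ = 4 ^ μ * y ^ μ := Real.mul_rpow (by norm_num) h0.le
    _ ≤ 2 * y ^ μ := by gcongr

/-- Distance to the origin of the point at distance `ρ` from a point at distance `r` from the
origin, in the direction making an angle `θ` with the outer normal. -/
def coneRad (r ρ θ : ℝ) : ℝ := √(r ^ 2 + ρ ^ 2 + 2 * r * ρ * Real.cos θ)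

theorem abs_sub_le_coneRad {r ρ : ℝ} (hr : 0 ≤ r) (hρ : 0 ≤ ρ) (θ : ℝ) :
    |r - ρ| ≤ coneRad r ρ θ := by
  apply Real.abs_le_sqrt
  nlinarith [Real.neg_one_le_cos θ, mul_nonneg hr hρ]

theorem coneRad_le_add {r ρ : ℝ} (hr : 0 ≤ r) (hρ : 0 ≤ ρ) (θ : ℝ) :
    coneRad r ρ θ ≤ r + ρ := by
  apply Real.sqrt_le_iff.2 ⟨by positivity, ?_⟩
  nlinarith [Real.cos_le_one θ, mul_nonneg hr hρ]

theorem sq_coneRad_pos (r : ℝ) {ρ θ : ℝ} (hρ : 0 < ρ) (hθ : θ ∈ Set.Ioo 0 Real.pi) :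
    0 < r ^ 2 + ρ ^ 2 + 2 * r * ρ * Real.cos θ := by
  have h1 := Real.sin_pos_of_mem_Ioo hθ
  have h2 := Real.sin_sq_add_cos_sq θ
  have h3 : r ^ 2 + ρ ^ 2 + 2 * r * ρ * Real.cos θ
      = (r + ρ * Real.cos θ) ^ 2 + (ρ * Real.sin θ) ^ 2 := by
    linear_combination (-ρ ^ 2) * h2
  rw [h3]
  positivity

theorem hasDerivAt_coneRad_theta (r : ℝ) {ρ θ : ℝ} (hρ : 0 < ρ) (hθ : θ ∈ Set.Ioo 0 Real.pi) :
    HasDerivAt (fun θ => coneRad r ρ θ) (-(r * ρ * Real.sin θ / coneRad r ρ θ)) θ := by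
  have h := (((Real.hasDerivAt_cos θ).const_mul (2 * r * ρ)).const_add (r ^ 2 + ρ ^ 2)).sqrt
    (sq_coneRad_pos r hρ hθ).ne'
  refine h.congr_deriv ?_
  have : 0 < coneRad r ρ θ := Real.sqrt_pos.2 (sq_coneRad_pos r hρ hθ)
  rw [← coneRad]
  field_simp

theorem hasDerivAt_coneRad_rho (r : ℝ) {ρ θ : ℝ} (hρ : 0 < ρ) (hθ : θ ∈ Set.Ioo 0 Real.pi) :
    HasDerivAt (fun ρ => coneRad r ρ θ) ((ρ + r * Real.cos θ) / coneRad r ρ θ) ρ := by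
  have h := ((((hasDerivAt_id ρ).pow 2).const_add (r ^ 2)).add
    (((hasDerivAt_id ρ).const_mul (2 * r)).mul_const (Real.cos θ))).sqrt
    (sq_coneRad_pos r hρ hθ).ne'
  refine h.congr_deriv ?_
  have : 0 < coneRad r ρ θ := Real.sqrt_pos.2 (sq_coneRad_pos r hρ hθ)
  simp only [id, Pi.add_apply, Pi.pow_apply]
  rw [← coneRad]
  field_simp
  simp
  ring

/-- `F` is dominated by the decay of the source, on the backward cone whose vertex is at time `t`
and at distance `r` from the origin. -/
def ConeDecay (μ ν t r K : ℝ) (F : ℝ → ℝ → ℝ) : Prop :=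
  ∀ ρ ∈ Set.Icc 0 (t - 2), ∀ θ,
    (t - ρ - 1 ≤ coneRad r ρ θ → F ρ θ = 0) ∧
    (coneRad r ρ θ < t - ρ - 1 →
      |F ρ θ| ≤ K * (t - ρ) ^ (-2 - ν) * (t - ρ - coneRad r ρ θ) ^ (-1 + μ))

/-- On the support of the source, the time is comparable with its sum with `(t - r) / 2`. -/
theorem ConeDecay.le_rpow {μ ν t r K : ℝ} {F : ℝ → ℝ → ℝ} (hF : ConeDecay μ ν t r K F)
    (hν : |ν| ≤ 1 / 2) (hr : 0 ≤ r) (hrt : r < t) (hK : 0 ≤ K) {ρ : ℝ}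
    (hρ : ρ ∈ Set.Icc 0 (t - 2)) (θ : ℝ) (hθ : coneRad r ρ θ < t - ρ - 1) :
    F ρ θ ≤ 8 * K * (t - ρ + (t - r) / 2) ^ (-2 - ν) * (t - ρ - coneRad r ρ θ) ^ (-1 + μ) := by
  have h1 := (hF ρ hρ θ).2 hθ
  have h2 := abs_sub_le_coneRad hr hρ.1 θ
  have h3 := (abs_le.1 h2).1
  have hρ2 := hρ.2
  obtain ⟨hν1, hν2⟩ := abs_le.1 hν
  have hS : 0 < t - ρ + (t - r) / 2 := by linarith
  have h4 : (t - ρ) ^ (-2 - ν) ≤ 8 * (t - ρ + (t - r) / 2) ^ (-2 - ν) := by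
    calc (t - ρ) ^ (-2 - ν) ≤ ((t - ρ + (t - r) / 2) / 2) ^ (-2 - ν) := by
          apply Real.rpow_le_rpow_of_nonpos (by positivity) (by linarith) (by linarith)
      _ = (t - ρ + (t - r) / 2) ^ (-2 - ν) * 2 ^ (2 + ν) := by
          rw [Real.div_rpow hS.le (by norm_num), div_eq_mul_inv, ← Real.rpow_neg (by norm_num)]
          congr 2; ring
      _ ≤ (t - ρ + (t - r) / 2) ^ (-2 - ν) * 2 ^ (3 : ℝ) := by
          gcongr
          · norm_num
          · linarith
      _ = _ := by norm_num; ring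
  have hp : 0 < (t - ρ - coneRad r ρ θ) ^ (-1 + μ) := Real.rpow_pos_of_pos (by linarith) _
  calc F ρ θ ≤ _ := (le_abs_self _).trans h1
    _ ≤ K * (8 * (t - ρ + (t - r) / 2) ^ (-2 - ν)) * (t - ρ - coneRad r ρ θ) ^ (-1 + μ) := by
        gcongr
    _ = _ := by ring

theorem coneDecay_angular_integral_le {μ ν t r K : ℝ} {F : ℝ → ℝ → ℝ}
    (hF : ConeDecay μ ν t r K F) (hFc : Continuous (Function.uncurry F)) (hμ : 0 < μ)
    (hν : |ν| ≤ 1 / 2) (hr : 0 < r) (hrt : r < t) (hK : 0 ≤ K) {ρ : ℝ}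
    (hρ : ρ ∈ Set.Ioo 0 (t - 2)) :
    ∫ θ in (0:ℝ)..Real.pi, ρ * Real.sin θ * F ρ θ
      ≤ 16 * K * arsinhPrim μ (t - r) / r * (t - ρ + (t - r) / 2) ^ (-1 - ν) := by
  have hρ' : ρ ∈ Set.Icc 0 (t - 2) := Set.Ioo_subset_Icc_self hρ
  obtain ⟨hρ1, hρ2⟩ := hρ
  set S := t - ρ + (t - r) / 2 with hS
  have hS0 : 0 < S := by linarith
  have hSpow : S ^ (-1 - ν) = S ^ (-2 - ν) * S := by
    rw [← Real.rpow_add_one hS0.ne']; ring_nf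
  set c := 16 * K / r * S ^ (-1 - ν) with hc
  have hc0 : 0 ≤ c := by positivity
  have cR : Continuous fun θ => coneRad r ρ θ := by unfold coneRad; fun_prop
  have cX : Continuous (arsinhPrim μ) :=
    continuous_iff_continuousAt.2 fun y => (hasDerivAt_arsinhPrim hμ y).continuousAt
  have cF : Continuous fun θ => F ρ θ := hFc.comp (by fun_prop : Continuous fun θ : ℝ => (ρ, θ))
  have key := intervalIntegral.integral_le_sub_of_hasDeriv_right_of_le
    (φ := fun θ => ρ * Real.sin θ * F ρ θ)
    (g := fun θ => c * arsinhPrim μ (t - ρ - coneRad r ρ θ))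
    (g' := fun θ => c * (arsinhWeight μ (t - ρ - coneRad r ρ θ)
      * (r * ρ * Real.sin θ / coneRad r ρ θ))) Real.pi_pos.le
    (by apply Continuous.continuousOn; fun_prop)
    (fun θ hθ => by
      have h := (hasDerivAt_coneRad_theta r hρ1 hθ).const_sub (t - ρ)
      rw [neg_neg] at h
      exact (((hasDerivAt_arsinhPrim hμ _).comp θ h).const_mul c).hasDerivWithinAt)
    ((by fun_prop : Continuous fun θ => ρ * Real.sin θ * F ρ θ).continuousOn.integrableOn_Icc)
    (fun θ hθ => by
      have hsin := Real.sin_pos_of_mem_Ioo hθ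
      have hlam : 0 < coneRad r ρ θ := Real.sqrt_pos.2 (sq_coneRad_pos r hρ1 hθ)
      have hw := arsinhWeight_pos μ (t - ρ - coneRad r ρ θ)
      rcases le_or_gt (t - ρ - 1) (coneRad r ρ θ) with h | h
      · rw [(hF ρ hρ' θ).1 h, mul_zero]
        positivity
      · have h1 := hF.le_rpow hν hr.le hrt hK hρ' θ h
        have h2 := rpow_le_two_mul_arsinhWeight hμ
          (show 1 ≤ t - ρ - coneRad r ρ θ by linarith)
        have h3 : 1 ≤ S / coneRad r ρ θ := by rw [one_le_div hlam]; linarith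
        calc ρ * Real.sin θ * F ρ θ
            ≤ ρ * Real.sin θ * (8 * K * S ^ (-2 - ν) *
                (2 * arsinhWeight μ (t - ρ - coneRad r ρ θ)) * 1) := by
              rw [mul_one]
              gcongr
              exact h1.trans (by gcongr)
          _ ≤ ρ * Real.sin θ * (8 * K * S ^ (-2 - ν) *
                (2 * arsinhWeight μ (t - ρ - coneRad r ρ θ)) * (S / coneRad r ρ θ)) := by
              gcongr
          _ = _ := by
              rw [hc, hSpow]
              field_simp
              ring)
  refine key.trans ?_
  have hlam := abs_sub_le_coneRad hr.le hρ1.le Real.pi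
  have h1 : arsinhPrim μ (t - ρ - coneRad r ρ Real.pi) ≤ arsinhPrim μ (t - r) :=
    arsinhPrim_mono hμ (by linarith [(abs_le.1 hlam).2])
  have h2 := arsinhPrim_pos hμ (t - ρ - coneRad r ρ 0)
  calc _ ≤ c * arsinhPrim μ (t - r) := by
        nlinarith [mul_nonneg hc0 h2.le, mul_le_mul_of_nonneg_left h1 hc0]
    _ = _ := by rw [hc]; ring

theorem coneDecay_integral_le_of_pos {μ ν t r K : ℝ} {F : ℝ → ℝ → ℝ}
    (hF : ConeDecay μ ν t r K F) (hFc : Continuous (Function.uncurry F)) (hμ : 0 < μ)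
    (hν0 : ν ≠ 0) (hν : |ν| ≤ 1 / 2) (hr : 0 < r) (hrt : r < t) (ht : 2 ≤ t) (hK : 0 ≤ K) :
    ∫ θ in (0:ℝ)..Real.pi, ∫ ρ in (0:ℝ)..(t - 2), ρ * Real.sin θ * F ρ θ
      ≤ 16 * K * arsinhPrim μ (t - r) / r *
        ((2 + (t - r) / 2) ^ (-ν) / ν - (t + (t - r) / 2) ^ (-ν) / ν) := by
  have cF : Continuous fun q : ℝ × ℝ => q.1 * Real.sin q.2 * F q.1 q.2 := by
    have : Continuous fun q : ℝ × ℝ => F q.1 q.2 := hFc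
    fun_prop
  rw [integral_integral_swap_of_continuous (g := fun θ ρ => ρ * Real.sin θ * F ρ θ)
    (cF.comp continuous_swap)]
  have cI : Continuous fun ρ => ∫ θ in (0:ℝ)..Real.pi, ρ * Real.sin θ * F ρ θ :=
    intervalIntegral.continuous_parametric_intervalIntegral_of_continuous' cF 0 Real.pi
  set c := 16 * K * arsinhPrim μ (t - r) / r with hc
  have hd : ∀ ρ ≤ t - 2, HasDerivAt (fun ρ => c * ((t - ρ + (t - r) / 2) ^ (-ν) / ν))
      (c * (t - ρ + (t - r) / 2) ^ (-1 - ν)) ρ := by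
    intro ρ hρ
    have h1 : HasDerivAt (fun ρ => t - ρ + (t - r) / 2) (-1) ρ :=
      ((hasDerivAt_id ρ).const_sub t).add_const _
    refine (((h1.rpow_const (p := -ν) (Or.inl (by linarith))).div_const ν).const_mul
      c).congr_deriv ?_
    rw [show -ν - 1 = -1 - ν by ring]
    field_simp
  have key := intervalIntegral.integral_le_sub_of_hasDeriv_right_of_le
    (φ := fun ρ => ∫ θ in (0:ℝ)..Real.pi, ρ * Real.sin θ * F ρ θ)
    (g := fun ρ => c * ((t - ρ + (t - r) / 2) ^ (-ν) / ν))
    (g' := fun ρ => c * (t - ρ + (t - r) / 2) ^ (-1 - ν))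
    (sub_nonneg.2 ht)
    (fun ρ hρ => (hd ρ hρ.2).continuousAt.continuousWithinAt)
    (fun ρ hρ => (hd ρ hρ.2.le).hasDerivWithinAt)
    cI.continuousOn.integrableOn_Icc
    (fun ρ hρ => coneDecay_angular_integral_le hF hFc hμ hν hr hrt hK hρ)
  refine key.trans (le_of_eq ?_)
  rw [sub_sub_cancel, sub_zero]
  ring

theorem coneDecay_radial_integral_le {μ ν t r K : ℝ} {F : ℝ → ℝ → ℝ}
    (hF : ConeDecay μ ν t r K F) (hFc : Continuous (Function.uncurry F)) (hμ : 0 < μ)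
    (hμ' : μ ≤ 1 / 2) (hν : |ν| ≤ 1 / 2) (hr : 0 ≤ r) (hrt : 8 * r ≤ t) (ht : 2 ≤ t)
    (hK : 0 ≤ K) {θ : ℝ} (hθ : θ ∈ Set.Ioo 0 Real.pi) :
    ∫ ρ in (0:ℝ)..(t - 2), ρ * Real.sin θ * F ρ θ
      ≤ 3072 * K * t ^ (-2 - ν) * (t ^ μ * t) / μ := by
  have ht0 : 0 < t := by linarith
  have hsin := Real.sin_pos_of_mem_Ioo hθ
  obtain ⟨hν1, hν2⟩ := abs_le.1 hν
  set w := 512 * K * t ^ (-2 - ν) with hw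
  have hw0 : 0 ≤ w := by positivity
  have cR : Continuous fun ρ => coneRad r ρ θ := by unfold coneRad; fun_prop
  have cX : Continuous (arsinhPrim μ) :=
    continuous_iff_continuousAt.2 fun y => (hasDerivAt_arsinhPrim hμ y).continuousAt
  have cF : Continuous fun ρ => F ρ θ := hFc.comp (by fun_prop : Continuous fun ρ : ℝ => (ρ, θ))
  have key := intervalIntegral.integral_le_sub_of_hasDeriv_right_of_le
    (φ := fun ρ => ρ * Real.sin θ * F ρ θ)
    (g := fun ρ => w * Real.sin θ * (2 * t ^ μ * ρ - 2 * t * arsinhPrim μ (t - ρ - coneRad r ρ θ)))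
    (g' := fun ρ => w * Real.sin θ * (2 * t ^ μ + 2 * t * (arsinhWeight μ (t - ρ - coneRad r ρ θ)
      * (1 + (ρ + r * Real.cos θ) / coneRad r ρ θ)))) (sub_nonneg.2 ht)
    (by apply Continuous.continuousOn; fun_prop)
    (fun ρ hρ => by
      have h := ((hasDerivAt_id ρ).const_sub t).sub (hasDerivAt_coneRad_rho r hρ.1 hθ)
      have h' := ((((hasDerivAt_id ρ).const_mul (2 * t ^ μ)).sub
        (((hasDerivAt_arsinhPrim hμ _).comp ρ h).const_mul (2 * t))).const_mul
          (w * Real.sin θ))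
      refine (h'.congr_deriv ?_).hasDerivWithinAt
      simp only [Pi.sub_apply, id]
      ring)
    ((by fun_prop : Continuous fun ρ => ρ * Real.sin θ * F ρ θ).continuousOn.integrableOn_Icc)
    (fun ρ hρ => by
      have hρ' : ρ ∈ Set.Icc 0 (t - 2) := Set.Ioo_subset_Icc_self hρ
      obtain ⟨hρ1, hρ2⟩ := hρ
      have hlam : 0 < coneRad r ρ θ := Real.sqrt_pos.2 (sq_coneRad_pos r hρ1 hθ)
      have hχ := arsinhWeight_pos μ (t - ρ - coneRad r ρ θ)
      have hmono : 0 ≤ 1 + (ρ + r * Real.cos θ) / coneRad r ρ θ := by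
        have h1 : |ρ + r * Real.cos θ| ≤ coneRad r ρ θ := by
          apply Real.abs_le_sqrt
          nlinarith [Real.sin_sq_add_cos_sq θ, mul_nonneg (sq_nonneg r) (sq_nonneg (Real.sin θ))]
        have h2 : -1 ≤ (ρ + r * Real.cos θ) / coneRad r ρ θ := by
          rw [le_div_iff₀ hlam]; linarith [(abs_le.1 h1).1]
        linarith
      rcases le_or_gt (t - ρ - 1) (coneRad r ρ θ) with h | h
      · rw [(hF ρ hρ' θ).1 h, mul_zero]
        positivity
      · have h1 := hF.le_rpow hν hr (by linarith) hK hρ' θ h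
        have h2 := rpow_le_two_mul_arsinhWeight hμ
          (show 1 ≤ t - ρ - coneRad r ρ θ by linarith)
        have hS : (t - ρ + (t - r) / 2) ^ (-2 - ν) ≤ 64 * t ^ (-2 - ν) := by
          calc (t - ρ + (t - r) / 2) ^ (-2 - ν) ≤ (t / 4) ^ (-2 - ν) := by
                apply Real.rpow_le_rpow_of_nonpos (by positivity) (by linarith) (by linarith)
            _ = 4 ^ (2 + ν) * t ^ (-2 - ν) := by
                rw [Real.div_rpow ht0.le (by norm_num), div_eq_mul_inv,
                  ← Real.rpow_neg (by norm_num), mul_comm]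
                congr 2; ring
            _ ≤ 4 ^ (3:ℝ) * t ^ (-2 - ν) := by
                gcongr
                · norm_num
                · linarith
            _ = _ := by norm_num
        have hp : 0 < (t - ρ - coneRad r ρ θ) ^ (-1 + μ) := Real.rpow_pos_of_pos (by linarith) _
        have h3 : ρ * (t - ρ - coneRad r ρ θ) ^ (-1 + μ) ≤ 2 * t ^ μ
            + 2 * t * (arsinhWeight μ (t - ρ - coneRad r ρ θ)
              * (1 + (ρ + r * Real.cos θ) / coneRad r ρ θ)) := by
          rcases le_or_gt r ρ with hrρ | hrρ
          · have h4 : 0 ≤ (ρ + r * Real.cos θ) / coneRad r ρ θ := by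
              apply div_nonneg _ hlam.le
              nlinarith [Real.neg_one_le_cos θ]
            calc ρ * (t - ρ - coneRad r ρ θ) ^ (-1 + μ)
                ≤ t * (2 * arsinhWeight μ (t - ρ - coneRad r ρ θ)) := by
                  gcongr; linarith
              _ = 0 + 2 * t * (arsinhWeight μ (t - ρ - coneRad r ρ θ) * (1 + 0)) := by ring
              _ ≤ _ := by gcongr; positivity
          · have h5 := coneRad_le_add hr hρ1.le θ
            calc ρ * (t - ρ - coneRad r ρ θ) ^ (-1 + μ)
                ≤ t * (t / 2) ^ (-1 + μ) := by
                  gcongr ?_ * ?_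
                  · linarith
                  · apply Real.rpow_le_rpow_of_nonpos (by positivity) (by linarith) (by linarith)
              _ = 2 ^ (1 - μ) * t ^ μ := by
                  rw [Real.div_rpow ht0.le (by norm_num), div_eq_mul_inv,
                    ← Real.rpow_neg (by norm_num), Real.rpow_add ht0, Real.rpow_neg_one]
                  rw [show -(-1 + μ) = 1 - μ by ring]
                  field_simp
              _ ≤ 2 ^ (1 : ℝ) * t ^ μ := by
                  gcongr
                  · norm_num
                  · linarith
              _ = 2 * t ^ μ + 0 := by rw [Real.rpow_one, add_zero]
              _ ≤ _ := by gcongr; positivity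
        calc ρ * Real.sin θ * F ρ θ
            ≤ ρ * Real.sin θ * (8 * K * (64 * t ^ (-2 - ν)) *
                (t - ρ - coneRad r ρ θ) ^ (-1 + μ)) := by
              gcongr
              exact h1.trans (by gcongr)
          _ = w * Real.sin θ * (ρ * (t - ρ - coneRad r ρ θ) ^ (-1 + μ)) := by rw [hw]; ring
          _ ≤ _ := by gcongr)
  refine key.trans ?_
  have hX : arsinhPrim μ (t - 0 - coneRad r 0 θ) ≤ 2 * t ^ μ / μ := by
    refine (arsinhPrim_mono hμ ?_).trans (arsinhPrim_le hμ hμ' (show 1 ≤ t by linarith))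
    have : 0 ≤ coneRad r 0 θ := Real.sqrt_nonneg _
    linarith
  have hX' := arsinhPrim_pos hμ (t - (t - 2) - coneRad r (t - 2) θ)
  have h6 : t ^ μ ≤ t ^ μ / μ := by
    rw [le_div_iff₀ hμ]
    have : 0 < t ^ μ := by positivity
    nlinarith
  have hs1 := Real.sin_le_one θ
  calc _ = w * Real.sin θ * (2 * t ^ μ * (t - 2)
          - 2 * t * arsinhPrim μ (t - (t - 2) - coneRad r (t - 2) θ)
          + 2 * t * arsinhPrim μ (t - 0 - coneRad r 0 θ)) := by ring
    _ ≤ w * Real.sin θ * (2 * (t ^ μ / μ) * t - 0 + 2 * t * (2 * t ^ μ / μ)) := by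
        gcongr
        · linarith
        · positivity
    _ ≤ w * 1 * (2 * (t ^ μ / μ) * t - 0 + 2 * t * (2 * t ^ μ / μ)) := by
        have : 0 ≤ 2 * (t ^ μ / μ) * t - 0 + 2 * t * (2 * t ^ μ / μ) := by
          rw [sub_zero]; positivity
        gcongr
    _ = _ := by rw [hw]; ring

theorem intervalIntegral_le_mul_of_le {G : ℝ → ℝ} (hG : Continuous G) {b B : ℝ} (hb : 0 ≤ b)
    (h : ∀ x ∈ Set.Ioo 0 b, G x ≤ B) : ∫ x in (0:ℝ)..b, G x ≤ B * b := by
  have key := intervalIntegral.integral_le_sub_of_hasDeriv_right_of_le (φ := G)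
    (g := fun x => B * x) (g' := fun _ => B) hb (by fun_prop)
    (fun x _ => by simpa using ((hasDerivAt_id x).const_mul B).hasDerivWithinAt)
    hG.continuousOn.integrableOn_Icc h
  simpa using key

theorem coneDecay_integral_le_of_small {μ ν t r K : ℝ} {F : ℝ → ℝ → ℝ}
    (hF : ConeDecay μ ν t r K F) (hFc : Continuous (Function.uncurry F)) (hμ : 0 < μ)
    (hμ' : μ ≤ 1 / 2) (hν : |ν| ≤ 1 / 2) (hr : 0 ≤ r) (hrt : 8 * r ≤ t) (ht : 2 ≤ t)
    (hK : 0 ≤ K) :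
    ∫ θ in (0:ℝ)..Real.pi, ∫ ρ in (0:ℝ)..(t - 2), ρ * Real.sin θ * F ρ θ
      ≤ 12288 * K * t ^ (-2 - ν) * (t ^ μ * t) / μ := by
  have cF : Continuous fun q : ℝ × ℝ => q.2 * Real.sin q.1 * F q.2 q.1 := by
    have : Continuous fun q : ℝ × ℝ => F q.2 q.1 := hFc.comp continuous_swap
    fun_prop
  have cI : Continuous fun θ => ∫ ρ in (0:ℝ)..(t - 2), ρ * Real.sin θ * F ρ θ :=
    intervalIntegral.continuous_parametric_intervalIntegral_of_continuous' cF 0 (t - 2)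
  refine (intervalIntegral_le_mul_of_le cI Real.pi_pos.le fun θ hθ =>
    coneDecay_radial_integral_le hF hFc hμ hμ' hν hr hrt ht hK hθ).trans ?_
  have ht0 : 0 < t := by linarith
  have hB : 0 ≤ 3072 * K * t ^ (-2 - ν) * (t ^ μ * t) / μ := by positivity
  calc _ ≤ 3072 * K * t ^ (-2 - ν) * (t ^ μ * t) / μ * 4 := by
        gcongr; exact Real.pi_le_four
    _ = _ := by ring

theorem rpow_le_two_mul_rpow {p t a : ℝ} (hp : 0 < p) (hpt : p ≤ t) (htp : t ≤ 2 * p)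
    (ha : a ≤ 1) : t ^ a ≤ 2 * p ^ a := by
  have h1 : 1 ≤ t / p := (one_le_div hp).2 hpt
  have h2 : t / p ≤ 2 := (div_le_iff₀ hp).2 htp
  have h3 : (t / p) ^ a ≤ 2 := by
    calc (t / p) ^ a ≤ (t / p) ^ (1:ℝ) := Real.rpow_le_rpow_of_exponent_le h1 ha
      _ ≤ 2 := by rwa [Real.rpow_one]
  rwa [Real.div_rpow (hp.le.trans hpt) hp.le, div_le_iff₀ (by positivity)] at h3

theorem coneDecay_integral_le_of_exponent_pos {μ ν t r K : ℝ} {F : ℝ → ℝ → ℝ}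
    (hF : ConeDecay μ ν t r K F) (hFc : Continuous (Function.uncurry F)) (hμ : 0 < μ)
    (hμ' : μ ≤ 1 / 2) (hν0 : 0 < ν) (hν : ν ≤ 1 / 2) (hr : 0 ≤ r) (hrt : 1 < t - r)
    (ht : 2 ≤ t) (hK : 0 ≤ K) :
    ∫ θ in (0:ℝ)..Real.pi, ∫ ρ in (0:ℝ)..(t - 2), ρ * Real.sin θ * F ρ θ
      ≤ 30000 * K * (ν * μ)⁻¹ * (t - r) ^ (μ - ν) * t⁻¹ := by
  have ht0 : 0 < t := by linarith
  have hp0 : 0 < t - r := by linarith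
  have hνa : |ν| ≤ 1 / 2 := by rwa [abs_of_pos hν0]
  rcases le_or_gt (8 * r) t with h | h
  · refine (coneDecay_integral_le_of_small hF hFc hμ hμ' hνa hr h ht hK).trans ?_
    have h1 := rpow_le_two_mul_rpow hp0 (by linarith : t - r ≤ t) (by linarith)
      (show μ - ν ≤ 1 by linarith)
    have h2 : t ^ (-2 - ν) * (t ^ μ * t) = t ^ (μ - ν) * t⁻¹ := by
      rw [← Real.rpow_neg_one t, ← Real.rpow_add_one ht0.ne', ← Real.rpow_add ht0,
        ← Real.rpow_add ht0]
      ring_nf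
    have h3 : μ⁻¹ ≤ (ν * μ)⁻¹ := by
      gcongr; nlinarith
    calc 12288 * K * t ^ (-2 - ν) * (t ^ μ * t) / μ
        = 12288 * K * μ⁻¹ * (t ^ (-2 - ν) * (t ^ μ * t)) := by ring
      _ = 12288 * K * μ⁻¹ * (t ^ (μ - ν) * t⁻¹) := by rw [h2]
      _ ≤ 12288 * K * (ν * μ)⁻¹ * (2 * (t - r) ^ (μ - ν) * t⁻¹) := by gcongr
      _ = 24576 * (K * (ν * μ)⁻¹ * (t - r) ^ (μ - ν) * t⁻¹) := by ring
      _ ≤ 30000 * (K * (ν * μ)⁻¹ * (t - r) ^ (μ - ν) * t⁻¹) := by gcongr; norm_num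
      _ = _ := by ring
  · have hr0 : 0 < r := by linarith
    refine (coneDecay_integral_le_of_pos hF hFc hμ hν0.ne' hνa hr0 (by linarith) ht hK).trans ?_
    have h1 := arsinhPrim_le hμ hμ' hrt.le
    have h2 : (2 + (t - r) / 2) ^ (-ν) ≤ 2 * (t - r) ^ (-ν) := by
      calc (2 + (t - r) / 2) ^ (-ν) ≤ ((t - r) / 2) ^ (-ν) := by
            apply Real.rpow_le_rpow_of_nonpos (by positivity) (by linarith) (by linarith)
        _ = 2 ^ ν * (t - r) ^ (-ν) := by
            rw [Real.div_rpow hp0.le (by norm_num), div_eq_mul_inv,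
              ← Real.rpow_neg (by norm_num), neg_neg, mul_comm]
        _ ≤ 2 ^ (1:ℝ) * (t - r) ^ (-ν) := by
            gcongr
            · norm_num
            · linarith
        _ = _ := by rw [Real.rpow_one]
    have h3 : 0 ≤ (t + (t - r) / 2) ^ (-ν) / ν := by positivity
    have h4 : r⁻¹ ≤ 8 * t⁻¹ := by
      rw [← div_eq_mul_inv, inv_le_comm₀ hr0 (by positivity), inv_div]; linarith
    calc 16 * K * arsinhPrim μ (t - r) / r *
          ((2 + (t - r) / 2) ^ (-ν) / ν - (t + (t - r) / 2) ^ (-ν) / ν)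
        ≤ 16 * K * arsinhPrim μ (t - r) / r * (2 * (t - r) ^ (-ν) / ν) := by
          have := arsinhPrim_pos hμ (t - r)
          gcongr
          exact (sub_le_self _ h3).trans (by gcongr)
      _ = 16 * K * arsinhPrim μ (t - r) * r⁻¹ * (2 * (t - r) ^ (-ν) / ν) := by ring
      _ ≤ 16 * K * (2 * (t - r) ^ μ / μ) * (8 * t⁻¹) * (2 * (t - r) ^ (-ν) / ν) := by gcongr
      _ = 512 * (K * (ν * μ)⁻¹ * ((t - r) ^ μ * (t - r) ^ (-ν)) * t⁻¹) := by
          field_simp; ring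
      _ = 512 * (K * (ν * μ)⁻¹ * (t - r) ^ (μ - ν) * t⁻¹) := by
          rw [← Real.rpow_add hp0, ← sub_eq_add_neg]
      _ ≤ 30000 * (K * (ν * μ)⁻¹ * (t - r) ^ (μ - ν) * t⁻¹) := by gcongr; norm_num
      _ = _ := by ring

theorem coneDecay_integral_le_of_exponent_neg {μ ν t r K : ℝ} {F : ℝ → ℝ → ℝ}
    (hF : ConeDecay μ ν t r K F) (hFc : Continuous (Function.uncurry F)) (hμ : 0 < μ)
    (hμ' : μ ≤ 1 / 2) (hν0 : ν < 0) (hν : |ν| ≤ 1 / 2) (hr : 0 ≤ r) (hrt : 1 < t - r)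
    (ht : 2 ≤ t) (hK : 0 ≤ K) :
    ∫ θ in (0:ℝ)..Real.pi, ∫ ρ in (0:ℝ)..(t - 2), ρ * Real.sin θ * F ρ θ
      ≤ 30000 * K * (|ν| * μ)⁻¹ * (t - r) ^ μ * t ^ (-1 - ν) := by
  have ht0 : 0 < t := by linarith
  have hp0 : 0 < t - r := by linarith
  have hνp : 0 < |ν| := abs_pos.2 hν0.ne
  rcases le_or_gt (8 * r) t with h | h
  · refine (coneDecay_integral_le_of_small hF hFc hμ hμ' hν hr h ht hK).trans ?_
    have h1 := rpow_le_two_mul_rpow hp0 (by linarith : t - r ≤ t) (by linarith)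
      (show μ ≤ 1 by linarith)
    have h2 : t ^ (-2 - ν) * t = t ^ (-1 - ν) := by
      rw [← Real.rpow_add_one ht0.ne']
      ring_nf
    have h3 : μ⁻¹ ≤ (|ν| * μ)⁻¹ := by
      gcongr; nlinarith
    calc 12288 * K * t ^ (-2 - ν) * (t ^ μ * t) / μ
        = 12288 * K * μ⁻¹ * (t ^ μ * (t ^ (-2 - ν) * t)) := by ring
      _ ≤ 12288 * K * (|ν| * μ)⁻¹ * (2 * (t - r) ^ μ * (t ^ (-2 - ν) * t)) := by gcongr
      _ = 24576 * (K * (|ν| * μ)⁻¹ * (t - r) ^ μ * t ^ (-1 - ν)) := by rw [h2]; ring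
      _ ≤ 30000 * (K * (|ν| * μ)⁻¹ * (t - r) ^ μ * t ^ (-1 - ν)) := by gcongr; norm_num
      _ = _ := by ring
  · have hr0 : 0 < r := by linarith
    refine (coneDecay_integral_le_of_pos hF hFc hμ hν0.ne hν hr0 (by linarith) ht hK).trans ?_
    have h1 := arsinhPrim_le hμ hμ' hrt.le
    rw [abs_of_neg hν0] at hν hνp ⊢
    have h2 : (t + (t - r) / 2) ^ (-ν) ≤ 2 * t ^ (-ν) := by
      calc (t + (t - r) / 2) ^ (-ν) ≤ (2 * t) ^ (-ν) := by gcongr; linarith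
        _ = 2 ^ (-ν) * t ^ (-ν) := Real.mul_rpow (by norm_num) ht0.le
        _ ≤ 2 ^ (1:ℝ) * t ^ (-ν) := by
            gcongr
            · norm_num
            · linarith
        _ = _ := by rw [Real.rpow_one]
    have h3 : 0 ≤ (2 + (t - r) / 2) ^ (-ν) / -ν := by positivity
    have h4 : r⁻¹ ≤ 8 * t⁻¹ := by
      rw [← div_eq_mul_inv, inv_le_comm₀ hr0 (by positivity), inv_div]; linarith
    have h5 : (2 + (t - r) / 2) ^ (-ν) / ν - (t + (t - r) / 2) ^ (-ν) / ν
        ≤ 2 * t ^ (-ν) / -ν := by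
      calc _ = (t + (t - r) / 2) ^ (-ν) / -ν - (2 + (t - r) / 2) ^ (-ν) / -ν := by
            simp only [div_neg]; ring
        _ ≤ (t + (t - r) / 2) ^ (-ν) / -ν := sub_le_self _ h3
        _ ≤ _ := by gcongr
    calc 16 * K * arsinhPrim μ (t - r) / r *
          ((2 + (t - r) / 2) ^ (-ν) / ν - (t + (t - r) / 2) ^ (-ν) / ν)
        ≤ 16 * K * arsinhPrim μ (t - r) / r * (2 * t ^ (-ν) / -ν) := by
          have := arsinhPrim_pos hμ (t - r)
          gcongr
      _ = 16 * K * arsinhPrim μ (t - r) * r⁻¹ * (2 * t ^ (-ν) / -ν) := by ring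
      _ ≤ 16 * K * (2 * (t - r) ^ μ / μ) * (8 * t⁻¹) * (2 * t ^ (-ν) / -ν) := by gcongr
      _ = 512 * (K * (-ν * μ)⁻¹ * (t - r) ^ μ * (t⁻¹ * t ^ (-ν))) := by
          field_simp; ring
      _ = 512 * (K * (-ν * μ)⁻¹ * (t - r) ^ μ * t ^ (-1 - ν)) := by
          rw [← Real.rpow_neg_one t, ← Real.rpow_add ht0, ← sub_eq_add_neg]
      _ ≤ 30000 * (K * (-ν * μ)⁻¹ * (t - r) ^ μ * t ^ (-1 - ν)) := by gcongr; norm_num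
      _ = _ := by ring

end Estimates

section Frame

/-- There is an orthonormal frame of `ℝ³` whose last vector is radial at a given point. -/
theorem exists_orthogonal_matrix_radial (x : Fin 3 → ℝ) :
    ∃ Q : Matrix (Fin 3) (Fin 3) ℝ, Q * Q.transpose = 1 ∧
      ∀ a, x a = √(∑ a, x a ^ 2) * Q 2 a := by
  obtain ⟨v, hv, hxv⟩ : ∃ v : EuclideanSpace ℝ (Fin 3), ‖v‖ = 1 ∧
      ∀ a, x a = √(∑ a, x a ^ 2) * v a := by
    have hn : ‖(WithLp.toLp 2 x : EuclideanSpace ℝ (Fin 3))‖ = √(∑ a, x a ^ 2) := by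
      simp [EuclideanSpace.norm_eq]
    rcases eq_or_ne (WithLp.toLp 2 x : EuclideanSpace ℝ (Fin 3)) 0 with h | h
    · refine ⟨EuclideanSpace.single 0 1, by simp, fun a => ?_⟩
      have hx : x = 0 := by simpa using h
      simp [hx]
    · have h' := norm_ne_zero_iff.2 h
      refine ⟨(‖(WithLp.toLp 2 x : EuclideanSpace ℝ (Fin 3))‖)⁻¹ • WithLp.toLp 2 x, ?_,
        fun a => ?_⟩
      · rw [norm_smul, norm_inv, norm_norm, inv_mul_cancel₀ h']
      · rw [← hn]
        simp only [PiLp.smul_apply, smul_eq_mul]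
        field_simp
  obtain ⟨b, hb⟩ := Orthonormal.exists_orthonormalBasis_extension_of_card_eq (𝕜 := ℝ)
    (E := EuclideanSpace ℝ (Fin 3)) (ι := Fin 3) (by simp) (v := fun _ => v) (s := {2})
    ⟨fun _ => hv, fun i j hij => absurd (Subsingleton.elim i j) hij⟩
  refine ⟨Matrix.of fun i a => b i a, ?_, fun a => ?_⟩
  · ext i j
    have hij := orthonormal_iff_ite.1 b.orthonormal j i
    simp only [PiLp.inner_apply, RCLike.inner_apply, conj_trivial] at hij
    rw [Matrix.mul_apply, Matrix.one_apply]
    simp only [Matrix.transpose_apply, Matrix.of_apply]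
    rw [hij]
    simp only [eq_comm]
  · change x a = _ * b 2 a
    rw [hb 2 rfl]
    exact hxv a

/-- The frame of spatial vectors of `ℝ^{1+3}` given by the rows of a matrix. -/
def spatialFrame (Q : Matrix (Fin 3) (Fin 3) ℝ) (i : Fin 3) : Fin 4 → ℝ := Fin.cons 0 (Q i)

theorem pd_pd_eq {u : (Fin 4 → ℝ) → ℝ} (hu : ContDiff ℝ 2 u) (i : Fin 4) (p : Fin 4 → ℝ) :
    pd i (pd i u) p = fderiv ℝ (fderiv ℝ u) p (Pi.single i 1) (Pi.single i 1) := by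
  have h : HasFDerivAt (fderiv ℝ u) (fderiv ℝ (fderiv ℝ u) p) p :=
    ((contDiff_fderiv_of_two hu).differentiable (by norm_num) _).hasFDerivAt
  have h2 := h.clm_apply (hasFDerivAt_const (Pi.single i (1:ℝ) : Fin 4 → ℝ) p)
  change fderiv ℝ (fun p => fderiv ℝ u p (Pi.single i 1)) p (Pi.single i 1) = _
  rw [h2.fderiv]
  simp

theorem spatialFrame_eq_sum (Q : Matrix (Fin 3) (Fin 3) ℝ) (i : Fin 3) :
    spatialFrame Q i = ∑ a : Fin 3, Q i a • (Pi.single a.succ 1 : Fin 4 → ℝ) := by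
  ext k
  refine Fin.cases ?_ (fun b => ?_) k
  · simp [spatialFrame]
  · simp [spatialFrame, Pi.single_apply]

theorem sum_spatialFrame_apply {Q : Matrix (Fin 3) (Fin 3) ℝ} (hQ : Q * Q.transpose = 1)
    (B : (Fin 4 → ℝ) →L[ℝ] (Fin 4 → ℝ) →L[ℝ] ℝ) :
    ∑ i, B (spatialFrame Q i) (spatialFrame Q i)
      = ∑ a : Fin 3, B (Pi.single a.succ 1) (Pi.single a.succ 1) := by
  have hQ' : ∀ a b, ∑ i, Q i a * Q i b = if a = b then 1 else 0 := by
    intro a b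
    have h : Q.transpose * Q = 1 := mul_eq_one_comm.1 hQ
    have := congrFun (congrFun h a) b
    simpa [Matrix.mul_apply, Matrix.one_apply] using this
  simp only [spatialFrame_eq_sum, map_sum, map_smul, sum_apply,
    smul_apply, smul_eq_mul]
  calc _ = ∑ a : Fin 3, ∑ b : Fin 3, (∑ i, Q i a * Q i b) *
        B (Pi.single a.succ 1) (Pi.single b.succ 1) := by
        simp only [Fin.sum_univ_three]; ring
    _ = _ := by simp [hQ']

theorem frameBox_eq_box {u : (Fin 4 → ℝ) → ℝ} (hu : ContDiff ℝ 2 u)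
    {Q : Matrix (Fin 3) (Fin 3) ℝ} (hQ : Q * Q.transpose = 1) (p : Fin 4 → ℝ) :
    frameBox u (Pi.single 0 1) (spatialFrame Q) p = box u p := by
  simp only [frameBox, box, pd_pd_eq hu, sum_spatialFrame_apply hQ]

theorem conePt_zero (x₀ : Fin 4 → ℝ) (Q : Matrix (Fin 3) (Fin 3) ℝ) (ρ θ φ : ℝ) :
    conePt x₀ (Pi.single 0 1) (spatialFrame Q) ρ θ φ 0 = x₀ 0 - ρ := by
  simp [conePt, sphR, spatialFrame]
  ring

theorem rad_conePt {x₀ : Fin 4 → ℝ} {Q : Matrix (Fin 3) (Fin 3) ℝ} (hQ : Q * Q.transpose = 1)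
    (hx : ∀ a : Fin 3, x₀ a.succ = rad x₀ * Q 2 a) (ρ θ φ : ℝ) :
    rad (conePt x₀ (Pi.single 0 1) (spatialFrame Q) ρ θ φ) = coneRad (rad x₀) ρ θ := by
  rw [rad, coneRad]
  congr 1
  have hQ' : ∀ i j, ∑ a, Q i a * Q j a = if i = j then 1 else 0 := by
    intro i j
    have := congrFun (congrFun hQ i) j
    simpa [Matrix.mul_apply, Matrix.one_apply] using this
  have h00 := hQ' 0 0
  have h01 := hQ' 0 1
  have h02 := hQ' 0 2
  have h11 := hQ' 1 1
  have h12 := hQ' 1 2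
  have h22 := hQ' 2 2
  simp only [Fin.sum_univ_three, Fin.isValue, if_true, Fin.reduceEq, if_false]
    at h00 h01 h02 h11 h12 h22
  have hθ := Real.sin_sq_add_cos_sq θ
  have hφ := Real.sin_sq_add_cos_sq φ
  have hc : ∀ a : Fin 3, conePt x₀ (Pi.single 0 1) (spatialFrame Q) ρ θ φ a.succ
      = (ρ * Real.sin θ * Real.cos φ) * Q 0 a + (ρ * Real.sin θ * Real.sin φ) * Q 1 a
        + (rad x₀ + ρ * Real.cos θ) * Q 2 a := by
    intro a
    simp [conePt, sphR, spatialFrame, hx]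
    ring
  simp only [hc, Fin.sum_univ_three]
  set A := ρ * Real.sin θ * Real.cos φ with hA
  set B := ρ * Real.sin θ * Real.sin φ with hB
  set D := rad x₀ + ρ * Real.cos θ with hD
  have e1 : A ^ 2 + B ^ 2 + D ^ 2
      = rad x₀ ^ 2 + ρ ^ 2 + 2 * rad x₀ * ρ * Real.cos θ := by
    rw [hA, hB, hD]
    linear_combination ρ ^ 2 * hθ + ρ ^ 2 * Real.sin θ ^ 2 * hφ
  linear_combination e1 + A ^ 2 * h00 + B ^ 2 * h11 + D ^ 2 * h22 + 2 * A * B * h01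
    + 2 * A * D * h02 + 2 * B * D * h12

theorem fderiv_eq_zero_of_zero_data {u : (Fin 4 → ℝ) → ℝ} (hu : Differentiable ℝ u) {s : ℝ}
    (h0 : ∀ x : Fin 3 → ℝ, u (Fin.cons s x) = 0)
    (h1 : ∀ x : Fin 3 → ℝ, pd 0 u (Fin.cons s x) = 0) {p : Fin 4 → ℝ} (hp : p 0 = s) :
    fderiv ℝ u p = 0 := by
  have hcons : ∀ q : Fin 4 → ℝ, q 0 = s → q = Fin.cons s (Fin.tail q) := by
    intro q hq
    rw [← hq, Fin.cons_self_tail]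
  refine ContinuousLinearMap.coe_injective ((Pi.basisFun ℝ (Fin 4)).ext fun k => ?_)
  simp only [Pi.basisFun_apply, ContinuousLinearMap.coe_coe, zero_apply]
  refine Fin.cases ?_ (fun a => ?_) k
  · have := h1 (Fin.tail p)
    rwa [← hcons p hp] at this
  · have hl : HasDerivAt (fun z : ℝ => p + z • (Pi.single a.succ 1 : Fin 4 → ℝ))
        (Pi.single a.succ 1) 0 := by
      simpa using ((hasDerivAt_id (0:ℝ)).smul_const
        (Pi.single a.succ 1 : Fin 4 → ℝ)).const_add p
    have hd : HasFDerivAt u (fderiv ℝ u p) (p + (0:ℝ) • (Pi.single a.succ 1 : Fin 4 → ℝ)) := by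
      simpa using (hu p).hasFDerivAt
    have h2 := hd.comp_hasDerivAt (0:ℝ) hl
    have h3 : u ∘ (fun z : ℝ => p + z • (Pi.single a.succ 1 : Fin 4 → ℝ)) = fun _ => 0 := by
      ext z
      rw [Function.comp_apply, hcons (p + z • (Pi.single a.succ 1 : Fin 4 → ℝ)) (by simp [hp])]
      exact h0 _
    rw [h3] at h2
    exact h2.unique (hasDerivAt_const _ _)

/-- Kirchhoff's formula for the wave equation with zero data at time `2`, in terms of functions
that are dominated by the decay of the source. -/
theorem wave_eq_cone_integral {μ ν : ℝ} {f u : (Fin 4 → ℝ) → ℝ} {K : ℝ}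
    (hf : Continuous f) (hf0 : ∀ p : Fin 4 → ℝ, p 0 - 1 ≤ rad p → f p = 0)
    (hfK : ∀ p : Fin 4 → ℝ, 2 ≤ p 0 → rad p < p 0 - 1 →
      |f p| ≤ K * (p 0) ^ (-2 - ν) * (p 0 - rad p) ^ (-1 + μ))
    (hu : ContDiff ℝ 2 u) (hbox : ∀ p : Fin 4 → ℝ, 2 ≤ p 0 → box u p = f p)
    (h0 : ∀ x : Fin 3 → ℝ, u (Fin.cons 2 x) = 0)
    (h1 : ∀ x : Fin 3 → ℝ, pd 0 u (Fin.cons 2 x) = 0) {p : Fin 4 → ℝ} (hp : 2 ≤ p 0) :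
    ∃ F : ℝ → ℝ → ℝ → ℝ, Continuous (fun q : ℝ × ℝ × ℝ => F q.1 q.2.1 q.2.2) ∧
      (∀ φ, ConeDecay μ ν (p 0) (rad p) K (F φ)) ∧
      ∫ φ in (0:ℝ)..(2 * Real.pi), ∫ θ in (0:ℝ)..Real.pi, ∫ ρ in (0:ℝ)..(p 0 - 2),
        ρ * Real.sin θ * F φ ρ θ = 4 * Real.pi * u p := by
  obtain ⟨Q, hQ, hx⟩ := exists_orthogonal_matrix_radial fun a => p a.succ
  change ∀ a : Fin 3, p a.succ = rad p * Q 2 a at hx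
  set P := conePt p (Pi.single 0 1) (spatialFrame Q) with hP
  have cP : Continuous fun q : ℝ × ℝ × ℝ => P q.1 q.2.1 q.2.2 := continuous_conePt _ _ _
  have hP0 : ∀ ρ θ φ, P ρ θ φ 0 = p 0 - ρ := conePt_zero p Q
  have hPr : ∀ ρ θ φ, rad (P ρ θ φ) = coneRad (rad p) ρ θ := rad_conePt hQ hx
  refine ⟨fun φ ρ θ => f (P ρ θ φ), ?_, fun φ ρ hρ θ => ⟨fun h => ?_, fun h => ?_⟩, ?_⟩
  · exact hf.comp (cP.comp (by fun_prop : Continuous fun q : ℝ × ℝ × ℝ => (q.2.1, q.2.2, q.1)))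
  · exact hf0 _ (by rwa [hP0, hPr])
  · have := hfK (P ρ θ φ) (by rw [hP0]; linarith [hρ.2]) (by rwa [hP0, hPr])
    rwa [hP0, hPr] at this
  · rw [← kirchhoff hu p (Pi.single 0 1) (spatialFrame Q) (p 0 - 2) ?_ ?_]
    · refine intervalIntegral.integral_congr fun φ _ => intervalIntegral.integral_congr fun θ _ =>
        intervalIntegral.integral_congr fun ρ hρ => ?_
      rw [Set.uIcc_of_le (by linarith)] at hρ
      change _ * f (P ρ θ φ) = _ * frameBox u _ _ (P ρ θ φ)
      rw [frameBox_eq_box hu hQ, hbox _ (by rw [hP0]; linarith [hρ.2])]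
    · intro θ φ
      have hu0 : ∀ q : Fin 4 → ℝ, q 0 = 2 → u q = 0 := by
        intro q hq
        have := h0 (Fin.tail q)
        rwa [← hq, Fin.cons_self_tail] at this
      exact hu0 _ ((hP0 _ _ _).trans (by ring))
    · intro θ φ
      exact fderiv_eq_zero_of_zero_data (hu.differentiable (by norm_num)) h0 h1
        ((hP0 _ _ _).trans (by ring))

theorem ConeDecay.neg {μ ν t r K : ℝ} {F : ℝ → ℝ → ℝ} (hF : ConeDecay μ ν t r K F) :
    ConeDecay μ ν t r K fun ρ θ => -F ρ θ := fun ρ hρ θ =>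
  ⟨fun h => by simp [(hF ρ hρ θ).1 h], fun h => (abs_neg (F ρ θ)).trans_le ((hF ρ hρ θ).2 h)⟩

/-- A bound on the integrals of all admissible densities on half-planes bounds the average over
the azimuth. -/
theorem abs_le_of_cone_integral {μ ν t r K B U : ℝ} {F : ℝ → ℝ → ℝ → ℝ}
    (hFc : Continuous (fun q : ℝ × ℝ × ℝ => F q.1 q.2.1 q.2.2))
    (hF : ∀ φ, ConeDecay μ ν t r K (F φ))
    (hU : ∫ φ in (0:ℝ)..(2 * Real.pi), ∫ θ in (0:ℝ)..Real.pi, ∫ ρ in (0:ℝ)..(t - 2),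
        ρ * Real.sin θ * F φ ρ θ = 4 * Real.pi * U)
    (hB : ∀ G : ℝ → ℝ → ℝ, Continuous (Function.uncurry G) → ConeDecay μ ν t r K G →
      ∫ θ in (0:ℝ)..Real.pi, ∫ ρ in (0:ℝ)..(t - 2), ρ * Real.sin θ * G ρ θ ≤ B) :
    |U| ≤ B / 2 := by
  have upper : ∀ (F : ℝ → ℝ → ℝ → ℝ) (U : ℝ),
      Continuous (fun q : ℝ × ℝ × ℝ => F q.1 q.2.1 q.2.2) →
      (∀ φ, ConeDecay μ ν t r K (F φ)) →
      ∫ φ in (0:ℝ)..(2 * Real.pi), ∫ θ in (0:ℝ)..Real.pi, ∫ ρ in (0:ℝ)..(t - 2),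
        ρ * Real.sin θ * F φ ρ θ = 4 * Real.pi * U → U ≤ B / 2 := by
    intro F U hFc hF hU
    have c1 : Continuous fun q : (ℝ × ℝ) × ℝ => q.2 * Real.sin q.1.2 * F q.1.1 q.2 q.1.2 := by
      have := hFc.comp (by fun_prop : Continuous fun q : (ℝ × ℝ) × ℝ => (q.1.1, q.2, q.1.2))
      exact (by fun_prop : Continuous fun q : (ℝ × ℝ) × ℝ => q.2 * Real.sin q.1.2).mul this
    have c2 : Continuous fun q : ℝ × ℝ => ∫ ρ in (0:ℝ)..(t - 2),
        ρ * Real.sin q.2 * F q.1 ρ q.2 :=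
      intervalIntegral.continuous_parametric_intervalIntegral_of_continuous' c1 0 (t - 2)
    have c3 : Continuous fun φ => ∫ θ in (0:ℝ)..Real.pi, ∫ ρ in (0:ℝ)..(t - 2),
        ρ * Real.sin θ * F φ ρ θ :=
      intervalIntegral.continuous_parametric_intervalIntegral_of_continuous' c2 0 Real.pi
    have h := intervalIntegral_le_mul_of_le c3 (b := 2 * Real.pi) (B := B)
      (by positivity) fun φ _ => hB (F φ)
        (hFc.comp (by fun_prop : Continuous fun q : ℝ × ℝ => (φ, q))) (hF φ)
    rw [hU] at h
    have hπ := Real.pi_pos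
    by_contra! hc
    nlinarith
  refine abs_le.2 ⟨?_, upper F U hFc hF hU⟩
  have := upper (fun φ ρ θ => -F φ ρ θ) (-U) hFc.neg (fun φ => (hF φ).neg) (by
    simp only [mul_neg, intervalIntegral.integral_neg, hU])
  linarith

end Frame

/-- Pointwise estimate for the wave equation with decaying source
(Proposition 3.1, after LeFloch–Ma). -/
theorem stmt_5 : ∃ C > (0:ℝ),
    ∀ (μ ν : ℝ), 0 < μ → μ ≤ 1/2 → 0 < |ν| → |ν| ≤ 1/2 →
    ∀ (f u : (Fin 4 → ℝ) → ℝ) (Cf : ℝ), 0 < Cf →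
      Continuous f →
      -- f vanishes outside K = {r < t - 1}
      (∀ p : Fin 4 → ℝ, p 0 - 1 ≤ rad p → f p = 0) →
      -- decay of the source
      (∀ p : Fin 4 → ℝ, 2 ≤ p 0 → rad p < p 0 - 1 →
        |f p| ≤ Cf * (p 0) ^ (-2 - ν) * (p 0 - rad p) ^ (-1 + μ)) →
      ContDiff ℝ 2 u →
      (∀ p : Fin 4 → ℝ, 2 ≤ p 0 → box u p = f p) →
      (∀ x : Fin 3 → ℝ, u (Fin.cons 2 x) = 0) →
      (∀ x : Fin 3 → ℝ, pd 0 u (Fin.cons 2 x) = 0) →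
      ∀ p : Fin 4 → ℝ, 2 ≤ p 0 → rad p < p 0 →
        (0 < ν →
          |u p| ≤ C * Cf * (ν * μ)⁻¹ * (p 0 - rad p) ^ (μ - ν) * (p 0)⁻¹) ∧
        (ν < 0 →
          |u p| ≤ C * Cf * (|ν| * μ)⁻¹ * (p 0 - rad p) ^ μ * (p 0) ^ (-1 - ν)) := by
  refine ⟨15000, by norm_num, ?_⟩
  intro μ ν hμ hμ' _ hν f u Cf hCf hf hf0 hfK hu hbox h0 h1 p hp hrp
  have hr : 0 ≤ rad p := Real.sqrt_nonneg _
  have hpr : 0 < p 0 - rad p := sub_pos.2 hrp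
  have hp0 : 0 < p 0 := by linarith
  obtain ⟨F, hFc, hF, hU⟩ :=
    wave_eq_cone_integral (μ := μ) (ν := ν) (K := Cf) hf hf0 hfK hu hbox h0 h1 hp
  rcases le_or_gt (p 0 - rad p) 1 with hK | hK
  · have hzero : |u p| ≤ 0 / 2 := by
      refine abs_le_of_cone_integral hFc hF hU fun G _ hG => le_of_eq ?_
      have hz : ∀ θ, ∫ ρ in (0:ℝ)..(p 0 - 2), ρ * Real.sin θ * G ρ θ = 0 := by
        intro θ
        refine (intervalIntegral.integral_congr fun ρ hρ => ?_).trans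
          intervalIntegral.integral_zero
        rw [Set.uIcc_of_le (by linarith)] at hρ
        have h2 := (le_abs_self _).trans (abs_sub_le_coneRad hr hρ.1 θ)
        simp [(hG ρ hρ θ).1 (by linarith)]
      simp [hz]
    rw [zero_div] at hzero
    exact ⟨fun hν0 => hzero.trans (by positivity), fun hν0 => hzero.trans (by positivity)⟩
  · refine ⟨fun hν0 => ?_, fun hν0 => ?_⟩
    · refine (abs_le_of_cone_integral hFc hF hU fun G hGc hG =>
        coneDecay_integral_le_of_exponent_pos hG hGc hμ hμ' hν0
          ((le_abs_self ν).trans hν) hr hK hp hCf.le).trans (le_of_eq ?_)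
      ring
    · refine (abs_le_of_cone_integral hFc hF hU fun G hGc hG =>
        coneDecay_integral_le_of_exponent_neg hG hGc hμ hμ' hν0 hν hr hK hp
          hCf.le).trans (le_of_eq ?_)
      ring
end
end
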